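/- arXiv:2312.02838 — 6 statements merged into one kernel-verified Lean document; each statement's English description precedes it below -/
import Mathlib

section
/- Fix n ≥ 1. Let S be the set of all n-linear (multilinear) maps UT2^n → M2(F) of the form (a_1, …, a_n) ↦ w_0 · a_{σ(1)} · w_1 · a_{σ(2)} · w_2 ⋯ w_{n−1} · a_{σ(n)} · w_n, where σ ranges over the symmetric group S_n and each w_j ranges over {1, e22, e12} (1 denotes the 2×2 identity matrix and products are matrix products). Then the F-vector space spanned by S inside the space of multilinear maps has dimension exactly (n+2)·2^{n−1} + 2. (This is the n-th generalized codimension gc_n(UT2) of UT2 as a UT2-algebra under the multiplication action, since the evaluation map identifies GP_n/(GP_n ∩ GId(UT2)) with this span of multilinear maps.) -/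
/-- The standard matrix unit `e₁₂` in the algebra of `2×2` matrices. -/
def e12 (F : Type*) [Field F] : Matrix (Fin 2) (Fin 2) F := !![0, 1; 0, 0]

/-- The standard matrix unit `e₂₂` in the algebra of `2×2` matrices. -/
def e22 (F : Type*) [Field F] : Matrix (Fin 2) (Fin 2) F := !![0, 0; 0, 1]

/-- The `F`-subspace of `2×2` upper triangular matrices inside the full matrix algebra. -/
def UTsub (F : Type*) [Field F] : Submodule F (Matrix (Fin 2) (Fin 2) F) where
  carrier := {m | m 1 0 = 0}
  add_mem' := by
    intro a b ha hb
    simp only [Set.mem_setOf_eq, Matrix.add_apply] at *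
    rw [ha, hb, add_zero]
  zero_mem' := rfl
  smul_mem' := by
    intro c a ha
    simp only [Set.mem_setOf_eq, Matrix.smul_apply] at *
    rw [ha, smul_zero]

/-- The algebra `UT₂` of `2×2` upper triangular matrices, as a type. -/
abbrev UT (F : Type*) [Field F] := ↥(UTsub F)

namespace GeneralizedCodimension

open Finset

/-- Row index of the `k`-th upper triangular position, in the order `(0,0), (0,1), (1,1)`. -/
def row : Fin 3 → Fin 2 := ![0, 0, 1]

/-- Column index of the `k`-th upper triangular position. -/
def col : Fin 3 → Fin 2 := ![0, 1, 1]

variable {F : Type*} [Field F] {n : ℕ}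

/-- The `k`-th coordinate of an upper triangular matrix. -/
def coord (k : Fin 3) (m : UT F) : F := (m : Matrix (Fin 2) (Fin 2) F) (row k) (col k)

/-- The matrix unit at the `k`-th upper triangular position. -/
def matUnit (F : Type*) [Field F] (k : Fin 3) : UT F :=
  ⟨Matrix.single (row k) (col k) 1, by
    change Matrix.single (row k) (col k) (1 : F) 1 0 = 0
    fin_cases k <;> simp [row, col]⟩

lemma coord_matUnit (j k : Fin 3) : coord j (matUnit F k) = if j = k then 1 else 0 := by
  fin_cases j <;> fin_cases k <;> simp [coord, matUnit, row, col]

/-- The product over `l` of the coordinates prescribed by `g`. -/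
def monomial (l : List (Fin n)) (g : Fin n → Fin 3) (a : Fin n → UT F) : F :=
  (l.map fun i => coord (g i) (a i)).prod

/-- The matrix-valued map whose only nonzero entry, at position `p.1`, is the product of the
coordinates prescribed by `p.2`. -/
def unitMonomial (F : Type*) [Field F] (p : Fin 3 × (Fin n → Fin 3)) (a : Fin n → UT F) :
    Matrix (Fin 2) (Fin 2) F :=
  Matrix.single (row p.1) (col p.1) (∏ i, coord (p.2 i) (a i))

lemma linearIndependent_unitMonomial :
    LinearIndependent F (unitMonomial F : Fin 3 × (Fin n → Fin 3) → _) := by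
  let φ : ((Fin n → UT F) → Matrix (Fin 2) (Fin 2) F) →ₗ[F] (Fin 3 × (Fin n → Fin 3) → F) :=
    { toFun := fun f q => f (fun i => matUnit F (q.2 i)) (row q.1) (col q.1)
      map_add' := fun _ _ => rfl
      map_smul' := fun _ _ => rfl }
  refine LinearIndependent.of_comp φ ?_
  convert (Pi.basisFun F (Fin 3 × (Fin n → Fin 3))).linearIndependent using 1
  funext p
  funext q
  obtain ⟨j, g⟩ := p
  obtain ⟨k, h⟩ := q
  have hprod : (∏ i, coord (g i) (matUnit F (h i))) = if g = h then 1 else 0 := by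
    simp only [coord_matUnit, Finset.prod_ite_zero, Finset.prod_const_one, funext_iff,
      Finset.mem_univ, true_imp_iff]
  have hpos : (row j = row k ∧ col j = col k) ↔ j = k := by
    revert j k; decide
  change (Matrix.single (row j) (col j) (∏ i, coord (g i) (matUnit F (h i)))) (row k) (col k) = _
  rw [hprod, Matrix.single_apply, Pi.basisFun_apply, Pi.single_apply]
  simp only [hpos, Prod.mk.injEq, ← ite_and]
  simp only [eq_comm]

/-- The coordinate choices in which the off-diagonal coordinate occurs at most once. -/
def thin (n : ℕ) : Finset (Fin n → Fin 3) :=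
  Fintype.piFinset (fun _ => {0, 2}) ∪
    univ.biUnion fun i => Fintype.piFinset fun j => if j = i then {1} else {0, 2}

lemma mem_thin {g : Fin n → Fin 3} : g ∈ thin n ↔ ∀ i j, g i = 1 → g j = 1 → i = j := by
  have h02 : ∀ k : Fin 3, k ∈ ({0, 2} : Finset (Fin 3)) ↔ k ≠ 1 := by decide
  simp only [thin, mem_union, Fintype.mem_piFinset, h02, mem_biUnion, mem_univ, true_and]
  constructor
  · rintro (h | ⟨k, h⟩) i j hi hj
    · exact absurd hi (h i)
    · have key : ∀ m, g m = 1 → m = k := by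
        intro m hm
        by_contra hmk
        have := h m
        rw [if_neg hmk, h02] at this
        exact this hm
      rw [key i hi, key j hj]
  · intro h
    by_cases hg : ∃ i, g i = 1
    · obtain ⟨i, hi⟩ := hg
      refine Or.inr ⟨i, fun j => ?_⟩
      split_ifs with hj
      · simp [hj, hi]
      · rw [h02]
        exact fun hj' => hj (h _ _ hj' hi)
    · push Not at hg
      exact Or.inl hg

lemma card_thin : #(thin n) = 2 ^ n + n * 2 ^ (n - 1) := by
  rw [thin, card_union_of_disjoint, card_biUnion]
  · have h2 : #({0, 2} : Finset (Fin 3)) = 2 := by decide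
    simp [Fintype.card_piFinset, apply_ite Finset.card, h2, Finset.prod_ite, filter_ne',
      card_erase_of_mem]
  · intro i _ k _ hik
    refine Finset.disjoint_left.2 fun g h1 h3 => ?_
    rw [Fintype.mem_piFinset] at h1 h3
    have h4 := h1 i
    have h5 := h3 i
    rw [if_pos rfl, mem_singleton] at h4
    rw [if_neg hik, h4] at h5
    revert h5
    decide
  · rw [Finset.disjoint_left]
    intro g h1 h3
    obtain ⟨i, -, h3⟩ := mem_biUnion.1 h3
    rw [Fintype.mem_piFinset] at h1 h3
    have h4 := h1 i
    have h5 := h3 i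
    rw [if_pos rfl, mem_singleton] at h5
    rw [h5] at h4
    revert h4
    decide

/-- Indices of the matrix-unit monomials forming a basis of the span of generalized monomials. -/
def basisIndex (n : ℕ) : Finset (Fin 3 × (Fin n → Fin 3)) :=
  insert (0, fun _ => 0) (insert (2, fun _ => 2) ((thin n).image (Prod.mk 1)))

lemma card_basisIndex (hn : 1 ≤ n) : #(basisIndex n) = (n + 2) * 2 ^ (n - 1) + 2 := by
  rw [basisIndex, card_insert_of_notMem (by simp), card_insert_of_notMem (by simp),
    card_image_of_injective _ (Prod.mk_right_injective 1), card_thin]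
  obtain ⟨m, rfl⟩ := Nat.exists_eq_add_of_le' hn
  simp only [Nat.add_sub_cancel]
  ring

/-- The generators: evaluations of multilinear generalized monomials. -/
def evaluations (F : Type*) [Field F] (n : ℕ) :
    Set ((Fin n → UT F) → Matrix (Fin 2) (Fin 2) F) :=
  {f | ∃ (σ : Equiv.Perm (Fin n)) (w : Fin (n + 1) → Matrix (Fin 2) (Fin 2) F),
    (∀ j, w j ∈ ({1, e22 F, e12 F} : Set (Matrix (Fin 2) (Fin 2) F))) ∧
    f = fun a => w 0 * (List.ofFn fun i : Fin n =>
      (↑(a (σ i)) : Matrix (Fin 2) (Fin 2) F) * w i.succ).prod}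

/-- The product of `a i * w` over the pairs `(i, w)` in a list. -/
def word (L : List (Fin n × Matrix (Fin 2) (Fin 2) F)) (a : Fin n → UT F) :
    Matrix (Fin 2) (Fin 2) F :=
  (L.map fun p => (a p.1 : Matrix (Fin 2) (Fin 2) F) * p.2).prod

lemma word_cons (p : Fin n × Matrix (Fin 2) (Fin 2) F)
    (L : List (Fin n × Matrix (Fin 2) (Fin 2) F)) (a : Fin n → UT F) :
    word (p :: L) a = (a p.1 : Matrix (Fin 2) (Fin 2) F) * p.2 * word L a := by
  simp [word]

lemma monomial_cons (i : Fin n) (l : List (Fin n)) (g : Fin n → Fin 3) (a : Fin n → UT F) :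
    monomial (i :: l) g a = coord (g i) (a i) * monomial l g a := by
  simp [monomial]

lemma monomial_cons_update {i : Fin n} {l : List (Fin n)} (hi : i ∉ l) (g : Fin n → Fin 3)
    (k : Fin 3) (a : Fin n → UT F) :
    monomial (i :: l) (Function.update g i k) a = coord k (a i) * monomial l g a := by
  rw [monomial_cons, Function.update_self]
  congr 1
  unfold monomial
  congr 1
  refine List.map_congr_left fun j hj => ?_
  rw [Function.update_of_ne]
  rintro rfl
  exact hi hj

lemma monomial_eq_prod {l : List (Fin n)} (hl : l.Nodup) (hmem : ∀ i, i ∈ l)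
    (g : Fin n → Fin 3) (a : Fin n → UT F) :
    monomial l g a = ∏ i, coord (g i) (a i) := by
  rw [monomial, ← List.prod_toFinset _ hl]
  congr 1
  ext i
  simp [hmem]

/-- The span of the scalar monomials in the letters of `l` indexed by `thin n`. -/
def thinSpan (F : Type*) [Field F] (l : List (Fin n)) : Submodule F ((Fin n → UT F) → F) :=
  Submodule.span F ((fun g => monomial l g) '' (thin n : Set (Fin n → Fin 3)))

lemma update_zero_mem_thin {g : Fin n → Fin 3} (hg : g ∈ thin n) (i : Fin n) :
    Function.update g i 0 ∈ thin n := by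
  rw [mem_thin] at hg ⊢
  intro j k hj hk
  by_cases hji : j = i
  · simp [hji] at hj
  by_cases hki : k = i
  · simp [hki] at hk
  rw [Function.update_of_ne hji] at hj
  rw [Function.update_of_ne hki] at hk
  exact hg _ _ hj hk

lemma update_const_mem_thin (i : Fin n) (k : Fin 3) :
    Function.update (fun _ => 2) i k ∈ thin n := by
  rw [mem_thin]
  intro j m hj hm
  have key : ∀ t, Function.update (fun _ : Fin n => (2 : Fin 3)) i k t = 1 → t = i := by
    intro t ht
    by_contra hti
    simp [Function.update_of_ne hti] at ht
  rw [key j hj, key m hm]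

lemma const_two_mem_thin : (fun _ => 2 : Fin n → Fin 3) ∈ thin n := by
  simp [mem_thin]

lemma coord_mul_mem_thinSpan {i : Fin n} {l : List (Fin n)} (hi : i ∉ l)
    {f : (Fin n → UT F) → F} (hf : f ∈ thinSpan F l) :
    (fun a => coord 0 (a i) * f a) ∈ thinSpan F (i :: l) := by
  have hle : thinSpan F l ≤ (thinSpan F (i :: l)).comap
      (LinearMap.mulLeft F (fun a : Fin n → UT F => coord 0 (a i))) := by
    refine Submodule.span_le.2 ?_
    rintro _ ⟨g, hg, rfl⟩
    refine Submodule.subset_span ⟨_, update_zero_mem_thin hg i, ?_⟩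
    funext a
    exact monomial_cons_update hi g 0 a
  exact hle hf

lemma coord_mul_monomial_mem_thinSpan {i : Fin n} {l : List (Fin n)} (hi : i ∉ l) (k : Fin 3) :
    (fun a : Fin n → UT F => coord k (a i) * monomial l (fun _ => 2) a) ∈
      thinSpan F (i :: l) := by
  refine Submodule.subset_span ⟨_, update_const_mem_thin i k, ?_⟩
  funext a
  exact monomial_cons_update hi _ k a

lemma val_one_zero (m : UT F) : (m : Matrix (Fin 2) (Fin 2) F) 1 0 = 0 := m.2

lemma word_entries (L : List (Fin n × Matrix (Fin 2) (Fin 2) F))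
    (hL : (L.map Prod.fst).Nodup)
    (hw : ∀ p ∈ L, p.2 ∈ ({1, e22 F, e12 F} : Set (Matrix (Fin 2) (Fin 2) F))) :
    (∃ α : F, ∀ a, word L a 0 0 = α * monomial (L.map Prod.fst) (fun _ => 0) a) ∧
    (∃ β : F, ∀ a, word L a 1 1 = β * monomial (L.map Prod.fst) (fun _ => 2) a) ∧
    (∀ a, word L a 1 0 = 0) ∧
    (fun a => word L a 0 1) ∈ thinSpan F (L.map Prod.fst) := by
  induction L with
  | nil =>
    refine ⟨⟨1, fun a => by simp [word, monomial]⟩, ⟨1, fun a => by simp [word, monomial]⟩,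
      fun a => by simp [word], ?_⟩
    convert Submodule.zero_mem (thinSpan F _) using 1
    funext a
    simp [word]
  | cons p L ih =>
    obtain ⟨i, w⟩ := p
    simp only [List.map_cons, List.nodup_cons] at hL
    obtain ⟨⟨α, hα⟩, ⟨β, hβ⟩, h10, h01⟩ := ih hL.2 fun p hp => hw p (List.mem_cons_of_mem _ hp)
    have hx := coord_mul_mem_thinSpan hL.1 h01
    have hz := fun k => (thinSpan F (i :: L.map Prod.fst)).smul_mem β
      (coord_mul_monomial_mem_thinSpan (F := F) hL.1 k)
    have hw' := hw (i, w) List.mem_cons_self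
    simp only [Set.mem_insert_iff, Set.mem_singleton_iff] at hw'
    simp only [List.map_cons, word_cons, monomial_cons]
    rcases hw' with rfl | rfl | rfl
    · refine ⟨⟨α, fun a => ?_⟩, ⟨β, fun a => ?_⟩, fun a => ?_, ?_⟩
      · simp [Matrix.mul_apply, hα, h10, coord, row, col]; ring
      · simp [Matrix.mul_apply, hβ, val_one_zero, coord, row, col]; ring
      · simp [Matrix.mul_apply, h10, val_one_zero]
      · convert Submodule.add_mem _ hx (hz 1) using 1
        funext a
        simp [Matrix.mul_apply, hβ, coord, row, col]; ring
    · refine ⟨⟨0, fun a => ?_⟩, ⟨β, fun a => ?_⟩, fun a => ?_, ?_⟩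
      · simp [Matrix.mul_apply, h10, e22]
      · simp [Matrix.mul_apply, hβ, e22, coord, row, col]; ring
      · simp [Matrix.mul_apply, h10, e22]
      · convert hz 1 using 1
        funext a
        simp [Matrix.mul_apply, hβ, e22, coord, row, col]; ring
    · refine ⟨⟨0, fun a => ?_⟩, ⟨0, fun a => ?_⟩, fun a => ?_, ?_⟩
      · simp [Matrix.mul_apply, h10, e12]
      · simp [Matrix.mul_apply, val_one_zero, e12]
      · simp [Matrix.mul_apply, h10, e12]
      · convert hz 0 using 1
        funext a
        simp [Matrix.mul_apply, hβ, e12, coord, row, col]; ring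

/-- The span of the matrix-unit monomials indexed by `basisIndex n`. -/
def basisSpan (F : Type*) [Field F] (n : ℕ) :
    Submodule F ((Fin n → UT F) → Matrix (Fin 2) (Fin 2) F) :=
  Submodule.span F (unitMonomial F '' (basisIndex n : Set (Fin 3 × (Fin n → Fin 3))))

lemma single_mem_basisSpan {l : List (Fin n)} (hl : l.Nodup) (hmem : ∀ i, i ∈ l)
    {f : (Fin n → UT F) → F} (hf : f ∈ thinSpan F l) :
    (fun a => Matrix.single 0 1 (f a)) ∈ basisSpan F n := by
  let ψ : ((Fin n → UT F) → F) →ₗ[F] ((Fin n → UT F) → Matrix (Fin 2) (Fin 2) F) :=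
    (Matrix.singleLinearMap F (0 : Fin 2) (1 : Fin 2)).compLeft _
  have hle : thinSpan F l ≤ (basisSpan F n).comap ψ := by
    refine Submodule.span_le.2 ?_
    rintro _ ⟨g, hg, rfl⟩
    refine Submodule.subset_span ⟨(1, g), ?_, ?_⟩
    · simpa [basisIndex] using hg
    · funext a
      simp only [ψ, unitMonomial, ← monomial_eq_prod hl hmem]
      rfl
  exact hle hf

lemma upper_eq {M : Matrix (Fin 2) (Fin 2) F} (h : M 1 0 = 0) :
    M = Matrix.single 0 0 (M 0 0) + Matrix.single 1 1 (M 1 1) + Matrix.single 0 1 (M 0 1) := by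
  ext i j
  fin_cases i <;> fin_cases j <;> simp [h]

lemma mul_word_mem_basisSpan {L : List (Fin n × Matrix (Fin 2) (Fin 2) F)}
    (hL : (L.map Prod.fst).Nodup) (hmem : ∀ i, i ∈ L.map Prod.fst)
    (hw : ∀ p ∈ L, p.2 ∈ ({1, e22 F, e12 F} : Set (Matrix (Fin 2) (Fin 2) F)))
    {w : Matrix (Fin 2) (Fin 2) F} (h10 : w 1 0 = 0) :
    (fun a => w * word L a) ∈ basisSpan F n := by
  obtain ⟨⟨α, hα⟩, ⟨β, hβ⟩, hz, h01⟩ := word_entries L hL hw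
  have h0 : unitMonomial F (0, fun _ : Fin n => 0) ∈ basisSpan F n :=
    Submodule.subset_span ⟨_, by simp [basisIndex], rfl⟩
  have h2 : unitMonomial F (2, fun _ : Fin n => 2) ∈ basisSpan F n :=
    Submodule.subset_span ⟨_, by simp [basisIndex], rfl⟩
  have hB : (fun a => w 0 0 * word L a 0 1 + w 0 1 * word L a 1 1) ∈
      thinSpan F (L.map Prod.fst) := by
    refine Submodule.add_mem _ (Submodule.smul_mem _ (w 0 0) h01) ?_
    convert Submodule.smul_mem (thinSpan F (L.map Prod.fst)) (w 0 1 * β) (Submodule.subset_span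
      (Set.mem_image_of_mem (fun g => monomial (F := F) (L.map Prod.fst) g)
        (const_two_mem_thin (n := n)))) using 1
    funext a
    simp [hβ]; ring
  convert Submodule.add_mem _ (Submodule.add_mem _ (Submodule.smul_mem _ (w 0 0 * α) h0)
    (Submodule.smul_mem _ (w 1 1 * β) h2)) (single_mem_basisSpan hL hmem hB) using 1
  funext a
  rw [upper_eq (M := w * word L a) (by simp [Matrix.mul_apply, hz, h10])]
  have e0 : (w * word L a) 0 0 = w 0 0 * α * monomial (L.map Prod.fst) (fun _ => 0) a := by
    simp [Matrix.mul_apply, hz, hα]; ring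
  have e2 : (w * word L a) 1 1 = w 1 1 * β * monomial (L.map Prod.fst) (fun _ => 2) a := by
    simp [Matrix.mul_apply, h10, hβ]; ring
  have e1 : (w * word L a) 0 1 = w 0 0 * word L a 0 1 + w 0 1 * word L a 1 1 := by
    simp [Matrix.mul_apply]
  rw [e0, e1, e2, monomial_eq_prod hL hmem, monomial_eq_prod hL hmem]
  simp [unitMonomial, row, col]

lemma span_evaluations_le : Submodule.span F (evaluations F n) ≤ basisSpan F n := by
  refine Submodule.span_le.2 ?_
  rintro _ ⟨σ, w, hw, rfl⟩
  have hfst : (List.ofFn fun i => (σ i, w i.succ)).map Prod.fst = List.ofFn σ := by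
    rw [List.map_ofFn]; rfl
  rw [SetLike.mem_coe]
  convert mul_word_mem_basisSpan (L := List.ofFn fun i => (σ i, w i.succ)) (w := w 0) ?_ ?_ ?_ ?_
    using 1
  · funext a
    rw [word, List.map_ofFn]
    rfl
  · rw [hfst]
    exact List.nodup_ofFn.2 σ.injective
  · rw [hfst]
    intro i
    simpa [List.mem_ofFn] using σ.surjective i
  · intro p hp
    obtain ⟨i, rfl⟩ := (List.mem_ofFn' _ _).1 hp
    exact hw _
  · have := hw 0
    simp only [Set.mem_insert_iff, Set.mem_singleton_iff] at this
    rcases this with h | h | h <;> simp [h, e22, e12]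

lemma mul_word_mem_evaluations {L : List (Fin n × Matrix (Fin 2) (Fin 2) F)}
    (hL : (L.map Prod.fst).Nodup) (hmem : ∀ i, i ∈ L.map Prod.fst)
    (hw : ∀ p ∈ L, p.2 ∈ ({1, e22 F, e12 F} : Set (Matrix (Fin 2) (Fin 2) F)))
    {w : Matrix (Fin 2) (Fin 2) F}
    (h0 : w ∈ ({1, e22 F, e12 F} : Set (Matrix (Fin 2) (Fin 2) F))) :
    (fun a => w * word L a) ∈ evaluations F n := by
  have hlen : n = L.length := by
    rw [← List.length_map (f := Prod.fst), ← List.toFinset_card_of_nodup hL]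
    rw [show (L.map Prod.fst).toFinset = univ by ext i; simpa using hmem i]
    simp
  let e : Fin n → Fin n × Matrix (Fin 2) (Fin 2) F := fun i => L.get (Fin.cast hlen i)
  have he : List.ofFn e = L := by
    apply List.ext_get
    · simpa using hlen
    · intro i h1 h2
      simp [e]
  have hfst : List.ofFn (Prod.fst ∘ e) = L.map Prod.fst := by
    rw [← List.map_ofFn, he]
  have hinj : Function.Injective (Prod.fst ∘ e) := by
    rw [← List.nodup_ofFn, hfst]
    exact hL
  refine ⟨Equiv.ofBijective _ (Finite.injective_iff_bijective.1 hinj),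
    Fin.cons w (fun i => (e i).2), ?_, ?_⟩
  · intro j
    refine Fin.cases ?_ (fun i => ?_) j
    · exact h0
    · exact hw _ (List.get_mem _ _)
  · funext a
    rw [word, ← he, List.map_ofFn]
    rfl

/-- The product of the matrices `a i` over a list of indices. -/
def listProd (l : List (Fin n)) (a : Fin n → UT F) : Matrix (Fin 2) (Fin 2) F :=
  (l.map fun i => (a i : Matrix (Fin 2) (Fin 2) F)).prod

lemma listProd_mul_mul_mem_evaluations (l₁ l₂ : List (Fin n)) (hl : (l₁ ++ l₂).Nodup)
    (hmem : ∀ i, i ∈ l₁ ++ l₂) {v : Matrix (Fin 2) (Fin 2) F}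
    (hv : v ∈ ({1, e22 F, e12 F} : Set (Matrix (Fin 2) (Fin 2) F))) :
    (fun a => listProd l₁ a * v * listProd l₂ a) ∈ evaluations F n := by
  have h1 : (1 : Matrix (Fin 2) (Fin 2) F) ∈
      ({1, e22 F, e12 F} : Set (Matrix (Fin 2) (Fin 2) F)) := by simp
  induction l₁ using List.reverseRecOn with
  | nil =>
    convert mul_word_mem_evaluations (L := l₂.map fun i => (i, 1)) (w := v) ?_ ?_ ?_ hv using 1
    · funext a
      simp [listProd, word, Function.comp_def]
    · simpa [Function.comp_def] using hl
    · simpa [Function.comp_def] using hmem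
    · simp
  | append_singleton l i _ =>
    convert mul_word_mem_evaluations
      (L := l.map (fun i => (i, 1)) ++ (i, v) :: l₂.map fun i => (i, 1)) (w := 1) ?_ ?_ ?_ h1
      using 1
    · funext a
      simp [listProd, word, Function.comp_def, mul_assoc]
    · simpa [Function.comp_def] using hl
    · simpa [Function.comp_def] using hmem
    · simp only [List.mem_append, List.mem_map, List.mem_cons]
      rintro p (⟨j, -, rfl⟩ | rfl | ⟨j, -, rfl⟩)
      exacts [h1, hv, h1]

lemma listProd_entries (l : List (Fin n)) (a : Fin n → UT F) :
    listProd l a 0 0 = monomial l (fun _ => 0) a ∧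
    listProd l a 1 1 = monomial l (fun _ => 2) a ∧ listProd l a 1 0 = 0 := by
  induction l with
  | nil => simp [listProd, monomial]
  | cons i l ih =>
    obtain ⟨h0, h2, h10⟩ := ih
    have hc : listProd (i :: l) a = (a i : Matrix (Fin 2) (Fin 2) F) * listProd l a := by
      simp [listProd]
    simp [hc, monomial_cons, Matrix.mul_apply, h0, h2, h10, val_one_zero, coord, row, col]

lemma listProd_append_singleton (l : List (Fin n)) (i : Fin n) (a : Fin n → UT F) :
    listProd (l ++ [i]) a = listProd l a * a i := by
  simp [listProd]

lemma monomial_congr {l : List (Fin n)} {g h : Fin n → Fin 3} (hgh : ∀ i ∈ l, g i = h i)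
    (a : Fin n → UT F) : monomial l g a = monomial l h a := by
  unfold monomial
  congr 1
  exact List.map_congr_left fun i hi => by rw [hgh i hi]

lemma monomial_append (l₁ l₂ : List (Fin n)) (g : Fin n → Fin 3) (a : Fin n → UT F) :
    monomial (l₁ ++ l₂) g a = monomial l₁ g a * monomial l₂ g a := by
  simp [monomial]

lemma unitMonomial_two_mem :
    unitMonomial F (2, fun _ : Fin n => 2) ∈ Submodule.span F (evaluations F n) := by
  refine Submodule.subset_span ?_
  convert listProd_mul_mul_mem_evaluations [] (List.finRange n) (List.nodup_finRange n)
    List.mem_finRange (v := e22 F) (by simp) using 1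
  funext a
  obtain ⟨-, h2, h10⟩ := listProd_entries (List.finRange n) a
  have hnil : listProd [] a = 1 := rfl
  simp only [unitMonomial, ← monomial_eq_prod (List.nodup_finRange n) List.mem_finRange, ← h2]
  ext i j
  fin_cases i <;> fin_cases j <;>
    simp [Matrix.mul_apply, e22, h10, row, col, hnil]

lemma unitMonomial_zero_mem :
    unitMonomial F (0, fun _ : Fin n => 0) ∈ Submodule.span F (evaluations F n) := by
  have hmem : ∀ i, i ∈ List.finRange n ++ [] := by simp
  have hl : (List.finRange n ++ []).Nodup := by simpa using List.nodup_finRange n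
  convert Submodule.sub_mem _
    (Submodule.subset_span (listProd_mul_mul_mem_evaluations (F := F) _ _ hl hmem (v := 1)
      (by simp)))
    (Submodule.subset_span (listProd_mul_mul_mem_evaluations (F := F) _ _ hl hmem (v := e22 F)
      (by simp))) using 1
  funext a
  obtain ⟨h0, -, h10⟩ := listProd_entries (List.finRange n) a
  have hnil : listProd [] a = 1 := rfl
  simp only [unitMonomial, ← monomial_eq_prod (List.nodup_finRange n) List.mem_finRange, ← h0,
    Pi.sub_apply, hnil]
  ext i j
  fin_cases i <;> fin_cases j <;>
    simp [Matrix.mul_apply, e22, h10, row, col]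

lemma single_listProd_mem (l₁ l₂ : List (Fin n)) (hl : (l₁ ++ l₂).Nodup)
    (hmem : ∀ i, i ∈ l₁ ++ l₂) :
    (fun a : Fin n → UT F => Matrix.single (0 : Fin 2) (1 : Fin 2)
      (listProd l₁ a 0 1 * monomial l₂ (fun _ => 2) a)) ∈
      Submodule.span F (evaluations F n) := by
  convert Submodule.sub_mem _
    (Submodule.subset_span (listProd_mul_mul_mem_evaluations (F := F) _ _ hl hmem (v := e22 F)
      (by simp))) unitMonomial_two_mem using 1
  funext a
  obtain ⟨-, h2, h10⟩ := listProd_entries l₁ a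
  obtain ⟨-, h2', h10'⟩ := listProd_entries l₂ a
  simp only [unitMonomial, ← monomial_eq_prod hl hmem, monomial_append, ← h2, ← h2',
    Pi.sub_apply]
  ext i j
  fin_cases i <;> fin_cases j <;>
    simp [Matrix.mul_apply, e22, h10, h10', row, col]

lemma unitMonomial_one_mem {g : Fin n → Fin 3} (hg : g ∈ thin n) :
    unitMonomial F (1, g) ∈ Submodule.span F (evaluations F n) := by
  rw [mem_thin] at hg
  have h3 : ∀ k : Fin 3, k = 0 ∨ k = 1 ∨ k = 2 := by decide
  set l₀ := (univ.filter fun i => g i = 0).toList with hl₀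
  set l₂ := (univ.filter fun i => g i = 2).toList with hl₂
  have m₀ : ∀ i, i ∈ l₀ ↔ g i = 0 := by simp [hl₀]
  have m₂ : ∀ i, i ∈ l₂ ↔ g i = 2 := by simp [hl₂]
  have n₀ : l₀.Nodup := nodup_toList _
  have n₂ : l₂.Nodup := nodup_toList _
  have disj : ∀ i ∈ l₀, i ∉ l₂ := by
    intro i hi
    rw [m₂, (m₀ i).1 hi]
    decide
  by_cases hy : ∃ i, g i = 1
  · obtain ⟨i, hi⟩ := hy
    have i₀ : i ∉ l₀ := by rw [m₀, hi]; decide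
    have i₂ : i ∉ l₂ := by rw [m₂, hi]; decide
    have hl : (l₀ ++ i :: l₂).Nodup := by
      rw [List.nodup_append']
      refine ⟨n₀, List.nodup_cons.2 ⟨i₂, n₂⟩, ?_⟩
      intro j hj hj'
      rcases List.mem_cons.1 hj' with rfl | hj'
      exacts [i₀ hj, disj j hj hj']
    have hmem : ∀ j, j ∈ l₀ ++ i :: l₂ := by
      intro j
      rw [List.mem_append, List.mem_cons, m₀, m₂]
      rcases h3 (g j) with h | h | h
      exacts [Or.inl h, Or.inr (Or.inl (hg _ _ h hi)), Or.inr (Or.inr h)]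
    have happ : l₀ ++ i :: l₂ = (l₀ ++ [i]) ++ l₂ := by simp
    convert Submodule.sub_mem _
      (single_listProd_mem (F := F) (l₀ ++ [i]) l₂ (happ ▸ hl) (happ ▸ hmem))
      (single_listProd_mem (F := F) l₀ (i :: l₂) hl hmem) using 1
    funext a
    obtain ⟨h0, -, -⟩ := listProd_entries l₀ a
    simp only [unitMonomial, Pi.sub_apply, ← monomial_eq_prod hl hmem, monomial_append,
      monomial_cons, listProd_append_singleton]
    rw [monomial_congr (h := fun _ => 0) fun j hj => (m₀ j).1 hj,
      monomial_congr (l := l₂) (h := fun _ => 2) fun j hj => (m₂ j).1 hj, ← h0, hi]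
    ext r c
    fin_cases r <;> fin_cases c <;>
      simp [Matrix.mul_apply, row, col, coord]
    ring
  · push Not at hy
    have hl : (l₀ ++ l₂).Nodup := by
      rw [List.nodup_append']
      exact ⟨n₀, n₂, fun j hj hj' => disj j hj hj'⟩
    have hmem : ∀ j, j ∈ l₀ ++ l₂ := by
      intro j
      rw [List.mem_append, m₀, m₂]
      rcases h3 (g j) with h | h | h
      exacts [Or.inl h, absurd h (hy j), Or.inr h]
    refine Submodule.subset_span ?_
    convert listProd_mul_mul_mem_evaluations (F := F) l₀ l₂ hl hmem (v := e12 F) (by simp) using 1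
    funext a
    obtain ⟨h0, -, h10⟩ := listProd_entries l₀ a
    obtain ⟨-, h2, h10'⟩ := listProd_entries l₂ a
    simp only [unitMonomial, ← monomial_eq_prod hl hmem, monomial_append]
    rw [monomial_congr (h := fun _ => 0) fun j hj => (m₀ j).1 hj,
      monomial_congr (l := l₂) (h := fun _ => 2) fun j hj => (m₂ j).1 hj, ← h0, ← h2]
    ext r c
    fin_cases r <;> fin_cases c <;>
      simp [Matrix.mul_apply, e12, h10, h10', row, col]

lemma span_evaluations : Submodule.span F (evaluations F n) = basisSpan F n := by
  refine le_antisymm span_evaluations_le (Submodule.span_le.2 ?_)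
  rintro _ ⟨p, hp, rfl⟩
  simp only [basisIndex, mem_coe, mem_insert, mem_image] at hp
  rcases hp with rfl | rfl | ⟨g, hg, rfl⟩
  exacts [unitMonomial_zero_mem, unitMonomial_two_mem, unitMonomial_one_mem hg]

lemma finrank_basisSpan : Module.finrank F (basisSpan F n) = #(basisIndex n) := by
  have hli : LinearIndependent F fun p : basisIndex n => unitMonomial F p.1 :=
    linearIndependent_unitMonomial.comp _ Subtype.val_injective
  have h := finrank_span_eq_card hli
  rw [Fintype.card_coe] at h
  rw [← h, basisSpan, Set.image_eq_range]
  rfl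

end GeneralizedCodimension

/-- Fix `n ≥ 1`. The `F`-span of all evaluations of multilinear generalized monomials
`(a₁,…,aₙ) ↦ w₀·a_{σ(1)}·w₁·a_{σ(2)}·w₂ ⋯ w_{n−1}·a_{σ(n)}·wₙ`, where `σ ∈ Sₙ` and each
`wⱼ ∈ {1, e₂₂, e₁₂}`, has dimension exactly `(n+2)·2^{n−1} + 2`; this is the `n`-th
generalized codimension `gcₙ(UT₂)` of `UT₂` as a `UT₂`-algebra. -/
theorem generalized_codimension_UT2 (F : Type*) [Field F] [CharZero F] (n : ℕ) (hn : 1 ≤ n) :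
    Module.finrank F (Submodule.span F
      {f : (Fin n → UT F) → Matrix (Fin 2) (Fin 2) F |
        ∃ (σ : Equiv.Perm (Fin n)) (w : Fin (n + 1) → Matrix (Fin 2) (Fin 2) F),
          (∀ j, w j ∈ ({1, e22 F, e12 F} : Set (Matrix (Fin 2) (Fin 2) F))) ∧
          f = fun a => w 0 * (List.ofFn fun i : Fin n =>
            (↑(a (σ i)) : Matrix (Fin 2) (Fin 2) F) * w i.succ).prod})
      = (n + 2) * 2 ^ (n - 1) + 2 := by
  exact (congrArg (fun V : Submodule F _ => Module.finrank F V)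
    GeneralizedCodimension.span_evaluations).trans
    (GeneralizedCodimension.finrank_basisSpan.trans
      (GeneralizedCodimension.card_basisIndex hn))
end

section
/- Fix n ≥ 1. Consider the following family of n-linear maps UT2^n → M2(F), where [u_1, u_2, …, u_r] denotes the left-normed commutator [[…[u_1,u_2],…],u_r]: (1) (a_1,…,a_n) ↦ a_1 a_2 ⋯ a_n; (2) (a_1,…,a_n) ↦ e22 · a_1 a_2 ⋯ a_n; (3) for every subset I = {i_1 < ⋯ < i_r} of {1,…,n} (0 ≤ r ≤ n) with complement {j_1 < ⋯ < j_{n−r}}, the map (a_1,…,a_n) ↦ a_{i_1} ⋯ a_{i_r} · e12 · a_{j_1} ⋯ a_{j_{n−r}}; (4) for every subset L = {l_1 < ⋯ < l_s} of {1,…,n} whose complement C has at least two elements, and every k ∈ C with k ≠ min C, writing C∖{k} = {m_1 < ⋯ < m_t}, the map (a_1,…,a_n) ↦ a_{l_1} ⋯ a_{l_s} · [a_k, a_{m_1}, …, a_{m_t}]; (5) for every subset P = {p_1 < ⋯ < p_u} of {1,…,n} with nonempty complement {q_1 < ⋯ < q_v}, the map (a_1,…,a_n) ↦ a_{p_1}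 ⋯ a_{p_u} · [a_{q_1}, e22, a_{q_2}, …, a_{q_v}]. Then this family of multilinear maps is linearly independent over F. -/
/-- The ordered product `a_{i₁}·a_{i₂} ⋯ a_{i_r}` over the elements `i₁ < i₂ < ⋯ < i_r`
of a finite set `s` of indices (the empty product is `1`). -/
def prodOn {F : Type*} [Field F] {n : ℕ} (a : Fin n → UT F) (s : Finset (Fin n)) :
    Matrix (Fin 2) (Fin 2) F :=
  ((s.sort (· ≤ ·)).map fun i => (↑(a i) : Matrix (Fin 2) (Fin 2) F)).prod

/-- The left-normed commutator `[u, v₁, v₂, …, v_r] = [[…[u,v₁],…],v_r]`. -/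
def lcomm {F : Type*} [Field F] (u : Matrix (Fin 2) (Fin 2) F)
    (l : List (Matrix (Fin 2) (Fin 2) F)) : Matrix (Fin 2) (Fin 2) F :=
  l.foldl (fun v w => v * w - w * v) u

/-- Index set for type (4): pairs `(L, k)` where `L ⊆ {1,…,n}`, `k` lies in the complement
`C` of `L`, and `k` is not the least element of `C` (so in particular `|C| ≥ 2`). -/
def Idx4 (n : ℕ) := {x : Finset (Fin n) × Fin n // x.2 ∈ x.1ᶜ ∧ ∃ m ∈ x.1ᶜ, m < x.2}

/-- Index set for type (5): subsets `P ⊆ {1,…,n}` with nonempty complement. -/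
def Idx5 (n : ℕ) := {P : Finset (Fin n) // Pᶜ.Nonempty}

/-- The family of multilinear evaluation maps `UT₂ⁿ → M₂(F)` forming a basis of the
multilinear generalized polynomials modulo `GId(UT₂)`:
(1) `a₁a₂⋯aₙ`; (2) `e₂₂·a₁a₂⋯aₙ`;
(3) `a_{i₁}⋯a_{i_r}·e₁₂·a_{j₁}⋯a_{j_{n−r}}` for `I = {i₁<⋯<i_r}` with complement
`{j₁<⋯<j_{n−r}}`;
(4) `a_{l₁}⋯a_{l_s}·[a_k, a_{m₁},…,a_{m_t}]` for `L = {l₁<⋯<l_s}` with complement `C`,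
`k ∈ C` not the minimum of `C`, and `C∖{k} = {m₁<⋯<m_t}`;
(5) `a_{p₁}⋯a_{p_u}·[a_{q₁}, e₂₂, a_{q₂},…,a_{q_v}]` for `P = {p₁<⋯<p_u}` with nonempty
complement `{q₁<⋯<q_v}`. -/
def basisFamily (F : Type*) [Field F] (n : ℕ) :
    (Unit ⊕ Unit) ⊕ Finset (Fin n) ⊕ Idx4 n ⊕ Idx5 n →
      (Fin n → UT F) → Matrix (Fin 2) (Fin 2) F
  | Sum.inl (Sum.inl _) => fun a => prodOn a Finset.univ
  | Sum.inl (Sum.inr _) => fun a => e22 F * prodOn a Finset.univ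
  | Sum.inr (Sum.inl I) => fun a => prodOn a I * e12 F * prodOn a Iᶜ
  | Sum.inr (Sum.inr (Sum.inl x)) => fun a =>
      prodOn a x.1.1 *
        lcomm (↑(a x.1.2))
          (((x.1.1ᶜ.erase x.1.2).sort (· ≤ ·)).map fun i =>
            (↑(a i) : Matrix (Fin 2) (Fin 2) F))
  | Sum.inr (Sum.inr (Sum.inr x)) => fun a =>
      prodOn a x.1 *
        lcomm (↑(a (x.1ᶜ.min' x.2)))
          (e22 F :: ((x.1ᶜ.erase (x.1ᶜ.min' x.2)).sort (· ≤ ·)).map fun i =>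
            (↑(a i) : Matrix (Fin 2) (Fin 2) F))

section

variable {F : Type*} [Field F] {n : ℕ}

theorem Matrix.list_prod_upperTriangular {ι : Type*} (f : ι → Matrix (Fin 2) (Fin 2) F)
    (hf : ∀ i, f i 1 0 = 0) (l : List ι) :
    (l.map f).prod 1 0 = 0 ∧ (l.map f).prod 0 0 = (l.map fun i => f i 0 0).prod ∧
      (l.map f).prod 1 1 = (l.map fun i => f i 1 1).prod := by
  induction l with
  | nil => simp
  | cons i l ih =>
    obtain ⟨h₁, h₂, h₃⟩ := ih
    simp [Matrix.mul_apply, Fin.sum_univ_two, h₁, h₂, h₃, hf i]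

theorem Finset.prod_map_sort {ι M : Type*} [LinearOrder ι] [CommMonoid M] (s : Finset ι)
    (f : ι → M) : ((s.sort (· ≤ ·)).map f).prod = ∏ i ∈ s, f i := by
  rw [← List.prod_toFinset f (s.sort_nodup (· ≤ ·)), s.sort_toFinset (· ≤ ·)]

theorem Finset.sort_eq_min'_cons {ι : Type*} [LinearOrder ι] (s : Finset ι) (hs : s.Nonempty) :
    s.sort (· ≤ ·) = s.min' hs :: (s.erase (s.min' hs)).sort (· ≤ ·) := by
  conv_lhs => rw [← Finset.insert_erase (s.min'_mem hs)]
  exact Finset.sort_insert (r := (· ≤ ·))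
    (fun b hb => s.min'_le b (Finset.mem_of_mem_erase hb)) (Finset.notMem_erase _ _)

theorem prodOn_apply_one_zero (a : Fin n → UT F) (s : Finset (Fin n)) : prodOn a s 1 0 = 0 :=
  (Matrix.list_prod_upperTriangular _ (fun i => (a i).2) _).1

theorem prodOn_apply_zero_zero (a : Fin n → UT F) (s : Finset (Fin n)) :
    prodOn a s 0 0 = ∏ i ∈ s, (a i).1 0 0 :=
  (Matrix.list_prod_upperTriangular _ (fun i => (a i).2) _).2.1.trans (s.prod_map_sort _)

theorem prodOn_apply_one_one (a : Fin n → UT F) (s : Finset (Fin n)) :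
    prodOn a s 1 1 = ∏ i ∈ s, (a i).1 1 1 :=
  (Matrix.list_prod_upperTriangular _ (fun i => (a i).2) _).2.2.trans (s.prod_map_sort _)

theorem lcomm_strictUpper {ι : Type*} (f : ι → Matrix (Fin 2) (Fin 2) F)
    (hf : ∀ i, f i 1 0 = 0) (l : List ι) (c : F) :
    lcomm !![0, c; 0, 0] (l.map f) =
      !![0, c * (l.map fun i => f i 1 1 - f i 0 0).prod; 0, 0] := by
  induction l generalizing c with
  | nil => simp [lcomm]
  | cons i l ih =>
    have h : !![0, c; 0, 0] * f i - f i * !![0, c; 0, 0] =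
        !![0, c * (f i 1 1 - f i 0 0); 0, 0] := by
      ext p q
      fin_cases p <;> fin_cases q <;>
        simp [Matrix.mul_apply, Fin.sum_univ_two, Matrix.vecMul, dotProduct, hf i]
      ring
    have h' : lcomm !![0, c; 0, 0] ((i :: l).map f) =
        lcomm !![0, c * (f i 1 1 - f i 0 0); 0, 0] (l.map f) := by
      rw [← h]; rfl
    rw [h', ih]
    simp [mul_assoc]

theorem lcomm_cons {ι : Type*} (f : ι → Matrix (Fin 2) (Fin 2) F)
    (hf : ∀ i, f i 1 0 = 0) (l : List ι) (u v : Matrix (Fin 2) (Fin 2) F)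
    (hu : u 1 0 = 0) (hv : v 1 0 = 0) :
    lcomm u (v :: l.map f) =
      !![0, (u 0 1 * (v 1 1 - v 0 0) - v 0 1 * (u 1 1 - u 0 0)) *
        (l.map fun i => f i 1 1 - f i 0 0).prod; 0, 0] := by
  rw [← lcomm_strictUpper f hf]
  have h : u * v - v * u =
      !![0, u 0 1 * (v 1 1 - v 0 0) - v 0 1 * (u 1 1 - u 0 0); 0, 0] := by
    ext p q
    fin_cases p <;> fin_cases q <;>
      simp [Matrix.mul_apply, Fin.sum_univ_two, hu, hv] <;> ring
  rw [← h]
  rfl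

/-- For `L ⊆ {1,…,n}` and an index `k`, the function `x_L · y_k · d_{C∖{k}}` with `C` the complement
of `L`, where `x`, `y`, `z` are the entries of the `aᵢ` and `d = z - x`. -/
def commTerm (a : Fin n → UT F) (L : Finset (Fin n)) (k : Fin n) : F :=
  (∏ i ∈ L, (a i).1 0 0) * (a k).1 0 1 * ∏ i ∈ Lᶜ.erase k, ((a i).1 1 1 - (a i).1 0 0)

theorem prodOn_mul_strictUpper (a : Fin n → UT F) (s : Finset (Fin n)) (c : F) :
    prodOn a s * !![0, c; 0, 0] = !![0, (∏ i ∈ s, (a i).1 0 0) * c; 0, 0] := by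
  ext p q
  fin_cases p <;> fin_cases q <;>
    simp [Matrix.mul_apply, Fin.sum_univ_two, prodOn_apply_one_zero, prodOn_apply_zero_zero]

theorem prodOn_mul_e12_mul_prodOn (a : Fin n → UT F) (s t : Finset (Fin n)) :
    prodOn a s * e12 F * prodOn a t =
      !![0, (∏ i ∈ s, (a i).1 0 0) * ∏ i ∈ t, (a i).1 1 1; 0, 0] := by
  rw [e12, prodOn_mul_strictUpper]
  ext p q
  fin_cases p <;> fin_cases q <;>
    simp [Matrix.mul_apply, Fin.sum_univ_two, prodOn_apply_one_zero, prodOn_apply_one_one]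

theorem Idx4.compl_nonempty (x : Idx4 n) : (x.1.1ᶜ).Nonempty := ⟨_, x.2.1⟩

theorem Idx4.min'_ne (x : Idx4 n) : x.1.1ᶜ.min' x.compl_nonempty ≠ x.1.2 := by
  obtain ⟨m, hm, hlt⟩ := x.2.2
  exact ((Finset.min'_le _ m hm).trans_lt hlt).ne

theorem basisFamily_idx4 (x : Idx4 n) (a : Fin n → UT F) :
    basisFamily F n (Sum.inr (Sum.inr (Sum.inl x))) a =
      !![0, commTerm a x.1.1 x.1.2 - commTerm a x.1.1 (x.1.1ᶜ.min' x.compl_nonempty); 0, 0] := by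
  set C := x.1.1ᶜ with hC
  set k := x.1.2
  set m := C.min' x.compl_nonempty with hm
  have hmk : m ≠ k := x.min'_ne
  have hkC : k ∈ C := x.2.1
  have hmC : m ∈ C := C.min'_mem _
  have hmC' : m ∈ C.erase k := Finset.mem_erase.2 ⟨hmk, hmC⟩
  have hmin : (C.erase k).min' ⟨m, hmC'⟩ = m :=
    le_antisymm (Finset.min'_le _ _ hmC')
      (C.min'_le _ (Finset.mem_of_mem_erase (Finset.min'_mem _ _)))
  have hsort := (C.erase k).sort_eq_min'_cons ⟨m, hmC'⟩
  rw [hmin] at hsort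
  change prodOn a x.1.1 * lcomm (a k).1 (((C.erase k).sort (· ≤ ·)).map fun i => (a i).1) = _
  rw [hsort, List.map_cons, lcomm_cons _ (fun i => (a i).2) _ _ _ (a k).2 (a m).2,
    Finset.prod_map_sort, prodOn_mul_strictUpper, commTerm, commTerm, ← hC,
    ← Finset.mul_prod_erase (C.erase k) _ hmC',
    ← Finset.mul_prod_erase (C.erase m) _ (Finset.mem_erase.2 ⟨hmk.symm, hkC⟩),
    Finset.erase_right_comm (a := m) (b := k)]
  congr 4
  ring

theorem basisFamily_idx5 (x : Idx5 n) (a : Fin n → UT F) :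
    basisFamily F n (Sum.inr (Sum.inr (Sum.inr x))) a =
      !![0, commTerm a x.1 (x.1ᶜ.min' x.2); 0, 0] := by
  change prodOn a x.1 * lcomm (a (x.1ᶜ.min' x.2)).1
    (e22 F :: ((x.1ᶜ.erase (x.1ᶜ.min' x.2)).sort (· ≤ ·)).map fun i => (a i).1) = _
  rw [lcomm_cons _ (fun i => (a i).2) _ _ _ (a _).2 (by simp [e22]),
    Finset.prod_map_sort, prodOn_mul_strictUpper, commTerm]
  simp [e22, mul_assoc]

/-- The upper triangular matrix with rows `(x, y)` and `(0, z)`. -/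
def UT.mk (x y z : F) : UT F := ⟨!![x, y; 0, z], rfl⟩

theorem prod_mem_indicator (s t : Finset (Fin n)) :
    ∏ i ∈ s, (if i ∈ t then (1 : F) else 0) = if s ⊆ t then 1 else 0 := by
  rw [Finset.prod_ite_zero]
  simp [Finset.subset_iff]

theorem commTerm_indicator {S L : Finset (Fin n)} {k j : Fin n} (hk : k ∉ S) :
    commTerm (fun i => UT.mk (if i ∈ S then (1 : F) else 0) (if i = k then 1 else 0) 1) L j =
      if L = S ∧ j = k then 1 else 0 := by
  have h : ∀ i, (1 : F) - (if i ∈ S then 1 else 0) = if i ∈ Sᶜ then 1 else 0 := by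
    intro i
    by_cases hi : i ∈ S <;> simp [hi]
  simp only [commTerm, UT.mk, Matrix.of_apply, Matrix.cons_val', Matrix.cons_val_zero,
    Matrix.cons_val_one, Matrix.cons_val_fin_one, h, prod_mem_indicator]
  by_cases hjk : j = k
  · subst hjk
    have : L = S ↔ L ⊆ S ∧ Lᶜ.erase j ⊆ Sᶜ := by
      constructor
      · rintro rfl
        exact ⟨subset_rfl, Finset.erase_subset _ _⟩
      · rintro ⟨h₁, h₂⟩
        refine h₁.antisymm fun i hi => ?_
        by_contra hiL
        have hij : i ≠ j := fun e => hk (e ▸ hi)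
        exact Finset.mem_compl.1
          (h₂ (Finset.mem_erase.2 ⟨hij, Finset.mem_compl.2 hiL⟩)) hi
    simp only [this]
    by_cases h₁ : L ⊆ S <;> by_cases h₂ : Lᶜ.erase j ⊆ Sᶜ <;> simp only [h₁, h₂] <;> simp
  · simp [hjk]

end

/-- Fix `n ≥ 1`. The family of multilinear maps `UT₂ⁿ → M₂(F)` of types (1)–(5) above is
linearly independent over `F` (Theorem 3.2: these evaluations form a basis of `GPₙ`
modulo `GPₙ ∩ GId(UT₂)`). -/
theorem basis_family_linearIndependent (F : Type*) [Field F] [CharZero F]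
    (n : ℕ) (hn : 1 ≤ n) :
    LinearIndependent F (basisFamily F n) := by
  classical
  have : Fintype (Idx4 n) := inferInstanceAs (Fintype (Subtype _))
  have : Fintype (Idx5 n) := inferInstanceAs (Fintype (Subtype _))
  rw [Fintype.linearIndependent_iff]
  intro g hg
  have H (a : Fin n → UT F) (p q : Fin 2) := congrFun₂ (congrFun hg a) p q
  simp only [Fintype.sum_sum_type, Finset.univ_unique, Finset.sum_singleton,
    Finset.sum_apply, Pi.smul_apply, basisFamily_idx4, basisFamily_idx5,
    Matrix.sum_apply, Matrix.smul_apply, smul_eq_mul, Pi.zero_apply, Matrix.zero_apply] at H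
  simp only [basisFamily, prodOn_mul_e12_mul_prodOn] at H
  have h₁ : g (Sum.inl (Sum.inl ())) = 0 := by
    simpa [Matrix.mul_apply, Fin.sum_univ_two, e22, prodOn_apply_zero_zero, UT.mk]
      using H (fun _ => UT.mk 1 0 1) 0 0
  have h₂ : g (Sum.inl (Sum.inr ())) = 0 := by
    simpa [Matrix.mul_apply, Fin.sum_univ_two, e22, prodOn_apply_one_one, UT.mk, h₁]
      using H (fun _ => UT.mk 1 0 1) 1 1
  have h₃ (I : Finset (Fin n)) : g (Sum.inr (Sum.inl I)) = 0 := by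
    have h := H (fun i => UT.mk (if i ∈ I then 1 else 0) 0 (if i ∈ Iᶜ then 1 else 0)) 0 1
    have hI (J : Finset (Fin n)) : I ⊆ J ∧ J ⊆ I ↔ J = I :=
      and_comm.trans Finset.Subset.antisymm_iff.symm
    simpa [h₁, h₂, UT.mk, commTerm, prod_mem_indicator, -Finset.mem_compl,
      ← ite_and, hI, and_comm] using h
  have key (S : Finset (Fin n)) (k : Fin n) (hk : k ∉ S) :
      ∑ x : Idx4 n, g (Sum.inr (Sum.inr (Sum.inl x))) *
          ((if x.1.1 = S ∧ x.1.2 = k then 1 else 0) -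
            (if x.1.1 = S ∧ x.1.1ᶜ.min' x.compl_nonempty = k then 1 else 0)) +
        ∑ x : Idx5 n, g (Sum.inr (Sum.inr (Sum.inr x))) *
          (if x.1 = S ∧ x.1ᶜ.min' x.2 = k then 1 else 0) = 0 := by
    have h := H (fun i => UT.mk (if i ∈ S then (1 : F) else 0) (if i = k then 1 else 0) 1) 0 1
    simpa only [h₁, h₂, h₃, commTerm_indicator hk, zero_mul, Finset.sum_const_zero, zero_add,
      Matrix.of_apply, Matrix.cons_val', Matrix.cons_val_zero, Matrix.cons_val_one,
      Matrix.cons_val_fin_one] using h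
  have h₄ (x : Idx4 n) : g (Sum.inr (Sum.inr (Sum.inl x))) = 0 := by
    have h := key x.1.1 x.1.2 (Finset.mem_compl.1 x.2.1)
    have hmin (L : Finset (Fin n)) (hL : Lᶜ.Nonempty) :
        ¬(L = x.1.1 ∧ Lᶜ.min' hL = x.1.2) := by
      rintro ⟨rfl, e⟩
      exact x.min'_ne e
    have hx (y : Idx4 n) : (y.1.1 = x.1.1 ∧ y.1.2 = x.1.2) ↔ y = x :=
      Prod.ext_iff.symm.trans Subtype.ext_iff.symm
    simpa [hmin, hx] using h
  have h₅ (x : Idx5 n) : g (Sum.inr (Sum.inr (Sum.inr x))) = 0 := by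
    have h := key x.1 (x.1ᶜ.min' x.2) (Finset.mem_compl.1 (Finset.min'_mem _ x.2))
    have hx (y : Idx5 n) : (y.1 = x.1 ∧ y.1ᶜ.min' y.2 = x.1ᶜ.min' x.2) ↔ y = x := by
      refine ⟨fun h => Subtype.ext h.1, ?_⟩
      rintro rfl
      exact ⟨rfl, rfl⟩
    simpa [h₄, hx] using h
  rintro ((⟨⟩ | ⟨⟩) | I | x | x)
  exacts [h₁, h₂, h₃ I, h₄ x, h₅ x]
end

section
/- Fix n ≥ 1. The following 2n+3 functions from UT2 to M2(F) are linearly independent over F (in the F-vector space of all functions UT2 → M2(F)): x ↦ x^n; x ↦ e22 · x^n; for each 1 ≤ i ≤ n, x ↦ x^{i−1} · (x·e22 − e22·x) · x^{n−i}; and for each 0 ≤ j ≤ n, x ↦ x^{j} · e12 · x^{n−j}. (This is the key step showing that the multiplicity of the trivial S_n-character χ_{(n)} in the n-th generalized cocharacter of UT2 is at least 2n+3; by Theorem 4.4 it equals 2n+3.) -/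
/-- The `2n+3` one-variable functions `UT₂ → M₂(F)` attached to the row partition `(n)`:
`x ↦ xⁿ`; `x ↦ e₂₂·xⁿ`; `x ↦ x^{i−1}·[x,e₂₂]·x^{n−i}` for `1 ≤ i ≤ n` (here indexed by
`i : Fin n`, i.e. `x ↦ xⁱ·[x,e₂₂]·x^{n−1−i}`); and `x ↦ xʲ·e₁₂·x^{n−j}` for `0 ≤ j ≤ n`. -/
def rowFamily (F : Type*) [Field F] (n : ℕ) :
    (Unit ⊕ Unit) ⊕ (Fin n ⊕ Fin (n + 1)) → UT F → Matrix (Fin 2) (Fin 2) F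
  | Sum.inl (Sum.inl _) => fun x => (↑x : Matrix (Fin 2) (Fin 2) F) ^ n
  | Sum.inl (Sum.inr _) => fun x => e22 F * (↑x : Matrix (Fin 2) (Fin 2) F) ^ n
  | Sum.inr (Sum.inl i) => fun x =>
      (↑x : Matrix (Fin 2) (Fin 2) F) ^ (i : ℕ) *
        ((↑x : Matrix (Fin 2) (Fin 2) F) * e22 F - e22 F * (↑x : Matrix (Fin 2) (Fin 2) F)) *
        (↑x : Matrix (Fin 2) (Fin 2) F) ^ (n - 1 - (i : ℕ))
  | Sum.inr (Sum.inr j) => fun x =>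
      (↑x : Matrix (Fin 2) (Fin 2) F) ^ (j : ℕ) * e12 F *
        (↑x : Matrix (Fin 2) (Fin 2) F) ^ (n - (j : ℕ))

/-- A power of an upper triangular `2×2` matrix with lower right entry `1` is again of this form,
and its upper left entry is the power of the upper left entry. -/
theorem exists_upperTriangular_pow_eq {R : Type*} [CommRing R] (a b : R) (k : ℕ) :
    ∃ d, (!![a, b; 0, 1] : Matrix (Fin 2) (Fin 2) R) ^ k = !![a ^ k, d; 0, 1] := by
  induction k with
  | zero => exact ⟨0, by simp [Matrix.one_fin_two]⟩
  | succ k ih =>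
    obtain ⟨d, hd⟩ := ih
    exact ⟨a ^ k * b + d, by rw [pow_succ, hd]; simp [pow_succ]⟩

/-- Multiplying a multiple of `e₁₂` by powers of an upper triangular matrix with lower right
entry `1`. -/
theorem upperTriangular_pow_mul_mul_pow {R : Type*} [CommRing R] (a b t : R) (k l : ℕ) :
    (!![a, b; 0, 1] : Matrix (Fin 2) (Fin 2) R) ^ k * !![0, t; 0, 0] * !![a, b; 0, 1] ^ l =
      !![0, a ^ k * t; 0, 0] := by
  obtain ⟨d, hd⟩ := exists_upperTriangular_pow_eq a b k
  obtain ⟨d', hd'⟩ := exists_upperTriangular_pow_eq a b l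
  rw [hd, hd']
  ext i j
  fin_cases i <;> fin_cases j <;> simp

/-- The coefficients of a polynomial function vanishing on a field of characteristic zero are
all zero. -/
theorem eq_zero_of_forall_sum_pow_mul_eq_zero {F : Type*} [Field F] [CharZero F] {m : ℕ}
    {v : Fin m → F} (h : ∀ a : F, ∑ i : Fin m, a ^ (i : ℕ) * v i = 0) : v = 0 :=
  Matrix.eq_zero_of_forall_index_sum_pow_mul_eq_zero
    (f := fun i : Fin m => ((i : ℕ) : F)) (fun _ _ hij => Fin.ext (Nat.cast_injective hij))
    fun _ => h _

/-- Fix `n ≥ 1`. The `2n+3` functions `UT₂ → M₂(F)` given by `x ↦ xⁿ`, `x ↦ e₂₂·xⁿ`,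
`x ↦ x^{i−1}·(x·e₂₂ − e₂₂·x)·x^{n−i}` (`1 ≤ i ≤ n`) and `x ↦ xʲ·e₁₂·x^{n−j}` (`0 ≤ j ≤ n`)
are linearly independent over `F`; hence `m_{(n)} ≥ 2n+3` in the generalized cocharacter. -/
theorem row_multiplicity_lower_bound (F : Type*) [Field F] [CharZero F] (n : ℕ) (hn : 1 ≤ n) :
    LinearIndependent F (rowFamily F n) := by
  rw [Fintype.linearIndependent_iff]
  intro g hg
  have key (x : UT F) := congrFun hg x
  simp only [Fintype.sum_sum_type, Finset.univ_unique, Finset.sum_singleton,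
    Pi.smul_apply, Finset.sum_apply, rowFamily, Pi.zero_apply] at key
  have hone := key ⟨1, Matrix.one_apply_ne one_ne_zero⟩
  have hα : g (Sum.inl (Sum.inl default)) = 0 := by
    simpa [e12, e22, Matrix.sum_apply] using congrFun (congrFun hone 0) 0
  have hβ : g (Sum.inl (Sum.inr default)) = 0 := by
    simpa [e12, e22, Matrix.sum_apply, hα] using congrFun (congrFun hone 1) 1
  have hsum (a b : F) : ∑ i : Fin n, g (Sum.inr (Sum.inl i)) * (a ^ (i : ℕ) * b) +
      ∑ j : Fin (n + 1), g (Sum.inr (Sum.inr j)) * a ^ (j : ℕ) = 0 := by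
    have hcomm : !![a, b; 0, 1] * e22 F - e22 F * !![a, b; 0, 1] = !![0, b; 0, 0] := by
      ext i j
      fin_cases i <;> fin_cases j <;> simp [e22]
    simpa only [hα, hβ, hcomm, e12, upperTriangular_pow_mul_mul_pow, zero_smul, zero_add,
      Matrix.add_apply, Matrix.sum_apply, Matrix.smul_apply, Matrix.of_apply, Matrix.cons_val',
      Matrix.cons_val_zero, Matrix.cons_val_one, Matrix.zero_apply, smul_eq_mul, mul_one] using
      congrFun (congrFun (key ⟨!![a, b; 0, 1], rfl⟩) 0) 1
  have hδ : (fun j : Fin (n + 1) => g (Sum.inr (Sum.inr j))) = 0 :=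
    eq_zero_of_forall_sum_pow_mul_eq_zero fun a => by simpa [mul_comm] using hsum a 0
  have hγ : (fun i : Fin n => g (Sum.inr (Sum.inl i))) = 0 :=
    eq_zero_of_forall_sum_pow_mul_eq_zero fun a => by
      simpa [mul_comm, fun j => congrFun hδ j] using hsum a 1
  rintro ((_ | _) | (i | j))
  exacts [hα, hβ, congrFun hγ i, congrFun hδ j]
end

section
/- For every n ≥ 1 the following identity holds in ℚ: Σ_{p=1}^{⌊n/2⌋} C(n,p) · (n−2p+1)^2 / (n−p+1) = 2^n − n − 1. (This computes Σ (q+1)·d_{(p+q,p)} over all two-row partitions (p+q,p) of n, where d_λ = C(n,p)(n−2p+1)/(n−p+1) is the degree of the irreducible S_n-character χ_{(p+q,p)}, q = n − 2p.) -/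
/-- The second central moment of the symmetric binomial distribution. -/
theorem sum_choose_mul_sub_two_mul_sq (m : ℕ) :
    ∑ p ∈ Finset.range (m + 1), (m.choose p : ℚ) * ((m : ℚ) - 2 * p) ^ 2 = (m : ℚ) * 2 ^ m := by
  have h := congrArg (Polynomial.eval (1 / 2 : ℚ)) (bernsteinPolynomial.variance ℚ m)
  simp only [bernsteinPolynomial, Polynomial.eval_finsetSum, Polynomial.eval_mul,
    Polynomial.eval_pow, Polynomial.eval_sub, Polynomial.eval_X, Polynomial.eval_natCast,
    Polynomial.eval_one, nsmul_eq_mul] at h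
  calc
    _ = ∑ p ∈ Finset.range (m + 1), 4 * 2 ^ m * (((m : ℚ) * (1 / 2) - p) ^ 2 *
          ((m.choose p : ℚ) * (1 / 2) ^ p * (1 - 1 / 2) ^ (m - p))) := by
      refine Finset.sum_congr rfl fun p hp => ?_
      have hpm : p + (m - p) = m := by have := Finset.mem_range.mp hp; omega
      have h2 : (2 : ℚ) ^ m * ((1 / 2) ^ p * (1 - 1 / 2) ^ (m - p)) = 1 := by
        rw [show (1 - 1 / 2 : ℚ) = 1 / 2 by norm_num, ← pow_add, hpm, ← mul_pow]
        norm_num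
      linear_combination (-(m.choose p : ℚ) * ((m : ℚ) - 2 * p) ^ 2) * h2
    _ = (m : ℚ) * 2 ^ m := by
      rw [← Finset.mul_sum, h]
      ring

/-- A sum over `0, …, n + 1` that is symmetric about its midpoint, where the summand vanishes,
is twice its first half. -/
theorem sum_range_eq_two_mul_sum_range_half (n : ℕ) (f : ℕ → ℚ)
    (hsymm : ∀ p ≤ n + 1, f (n + 1 - p) = f p) (hmid : ∀ p, 2 * p = n + 1 → f p = 0) :
    ∑ p ∈ Finset.range (n + 2), f p = 2 * ∑ p ∈ Finset.range (n / 2 + 1), f p := by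
  have htail (a k : ℕ) (h : a + k = n + 1) :
      ∑ i ∈ Finset.range (k + 1), f (a + i) = ∑ i ∈ Finset.range (k + 1), f i := by
    rw [← Finset.sum_range_reflect]
    refine Finset.sum_congr rfl fun i hi => ?_
    have := Finset.mem_range.mp hi
    rw [← hsymm i (by omega)]
    congr 1
    omega
  obtain ⟨k, rfl | rfl⟩ := Nat.even_or_odd' n
  · rw [show 2 * k + 2 = (k + 1) + (k + 1) by ring, Finset.sum_range_add,
      htail (k + 1) k (by ring), show 2 * k / 2 = k by omega]
    ring
  · rw [show 2 * k + 1 + 2 = (k + 1 + 1) + (k + 1) by ring, Finset.sum_range_add,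
      htail (k + 1 + 1) k (by ring), Finset.sum_range_succ _ (k + 1), hmid (k + 1) (by ring),
      show (2 * k + 1) / 2 = k by omega]
    ring

/-- For every `n ≥ 1`, the identity
`Σ_{p=1}^{⌊n/2⌋} C(n,p)·(n−2p+1)²/(n−p+1) = 2ⁿ − n − 1` holds in `ℚ`.
This computes `Σ (q+1)·d_{(p+q,p)}` over all two-row partitions of `n`. -/
theorem two_row_degree_sum (n : ℕ) (hn : 1 ≤ n) :
    ∑ p ∈ Finset.Icc 1 (n / 2),
        (n.choose p : ℚ) * ((n : ℚ) - 2 * p + 1) ^ 2 / ((n : ℚ) - p + 1)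
      = 2 ^ n - (n : ℚ) - 1 := by
  set g : ℕ → ℚ := fun p => ((n + 1).choose p : ℚ) * (((n + 1 : ℕ) : ℚ) - 2 * p) ^ 2 with hg
  have hn0 : (n : ℚ) + 1 ≠ 0 := by positivity
  have hterm : ∀ p ∈ Finset.Icc 1 (n / 2),
      (n.choose p : ℚ) * ((n : ℚ) - 2 * p + 1) ^ 2 / ((n : ℚ) - p + 1) = g p / (n + 1) := by
    intro p hp
    have hpn : p ≤ n := by have := Finset.mem_Icc.mp hp; omega
    have hc : (n.choose p : ℚ) * (n + 1) = (n + 1).choose p * ((n : ℚ) - p + 1) := by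
      have h := Nat.choose_mul_succ_eq n p
      rw [show n + 1 - p = n - p + 1 by omega] at h
      have h' := congrArg (Nat.cast : ℕ → ℚ) h
      push_cast [Nat.cast_sub hpn] at h'
      exact h'
    have hd : (n : ℚ) - p + 1 ≠ 0 := by
      have : (p : ℚ) ≤ n := by exact_mod_cast hpn
      linarith
    rw [div_eq_div_iff hd hn0, hg]
    push_cast
    linear_combination ((n : ℚ) - 2 * p + 1) ^ 2 * hc
  have hhalf := sum_range_eq_two_mul_sum_range_half n g
    (fun p hp => by
      simp only [hg, Nat.choose_symm hp, Nat.cast_sub hp]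
      ring)
    (fun p hp => by
      have : ((n + 1 : ℕ) : ℚ) = 2 * p := by rw [← hp]; push_cast; ring
      simp [hg, this])
  rw [sum_choose_mul_sub_two_mul_sq (n + 1), Finset.sum_range_succ'] at hhalf
  have hg0 : g 0 = ((n : ℚ) + 1) ^ 2 := by simp [hg]
  have hshift : ∑ p ∈ Finset.range (n / 2), g (p + 1) = ∑ p ∈ Finset.Icc 1 (n / 2), g p := by
    rw [Finset.range_eq_Ico, Finset.sum_Ico_add' g 0 (n / 2) 1]
    rfl
  rw [hg0, hshift] at hhalf
  rw [Finset.sum_congr rfl hterm, ← Finset.sum_div, div_eq_iff hn0]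
  push_cast at hhalf
  linear_combination -hhalf / 2
end

section
/- Fix n ≥ 1. Let S_D be the set of all n-linear maps UT2^n → M2(F) of the form (a_1, …, a_n) ↦ u_0 · a_{σ(1)} · u_1 · a_{σ(2)} · u_2 ⋯ u_{n−1} · a_{σ(n)} · u_n, where σ ranges over the symmetric group S_n and each u_j ranges over {1, e22} (1 the 2×2 identity matrix, products matrix products). Then the F-vector space spanned by S_D has dimension exactly n·2^{n−1} + 2. (This is the n-th generalized codimension gc_n(UT2^D) of UT2 regarded as a UT2-algebra under the action in which 1 and e22 act by multiplication and e12 acts as zero: monomials containing e12 evaluate to the zero map, so the span of all multilinear generalized monomial evaluations is exactly the span of S_D.) -/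
open Matrix

/-- The three coordinates (entries `00`, `01`, `11`) of an upper triangular `2×2` matrix. -/
def utCoord {F : Type*} [Field F] (c : Fin 3) (A : Matrix (Fin 2) (Fin 2) F) : F :=
  ![A 0 0, A 0 1, A 1 1] c

/-- The matrix units of `UT₂`, dual to the coordinates `utCoord`. -/
def utUnit (F : Type*) [Field F] (c : Fin 3) : UT F :=
  ⟨![!![1, 0; 0, 0], !![0, 1; 0, 0], !![0, 0; 0, 1]] c, by
    change (_ : Matrix (Fin 2) (Fin 2) F) 1 0 = 0
    fin_cases c <;> rfl⟩

lemma utCoord_utUnit {F : Type*} [Field F] (c d : Fin 3) :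
    utCoord c (utUnit F d : Matrix (Fin 2) (Fin 2) F) = if c = d then 1 else 0 := by
  fin_cases c <;> fin_cases d <;> simp [utCoord, utUnit]

/-- The multilinear map with the single matrix entry `p`, equal to the product of the coordinates
of the arguments prescribed by the word `w`. -/
def wordMap (F : Type*) [Field F] {n : ℕ} (w : Fin n → Fin 3) (p : Fin 2 × Fin 2) :
    (Fin n → UT F) → Matrix (Fin 2) (Fin 2) F :=
  fun a => single p.1 p.2 (∏ k, utCoord (w k) (a k : Matrix (Fin 2) (Fin 2) F))

lemma wordMap_utUnit {F : Type*} [Field F] {n : ℕ} (w w' : Fin n → Fin 3) (p : Fin 2 × Fin 2) :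
    wordMap F w p (fun k => utUnit F (w' k)) = if w = w' then single p.1 p.2 1 else 0 := by
  simp only [wordMap, utCoord_utUnit]
  split_ifs with h
  · simp [h]
  · obtain ⟨k, hk⟩ := Function.ne_iff.mp h
    rw [Finset.prod_eq_zero (Finset.mem_univ k) (if_neg hk), single_zero]

/-- Word maps attached to distinct words are linearly independent. -/
lemma linearIndependent_wordMap (F : Type*) [Field F] {n : ℕ} {ι : Type*}
    {w : ι → Fin n → Fin 3} (hw : Function.Injective w) (p : ι → Fin 2 × Fin 2) :
    LinearIndependent F fun i => wordMap F (w i) (p i) := by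
  classical
  rw [linearIndependent_iff']
  intro s g hg i hi
  have h := congrFun hg fun k => utUnit F (w i k)
  simp only [Finset.sum_apply, Pi.smul_apply, wordMap_utUnit, hw.eq_iff, smul_ite, smul_zero,
    Finset.sum_ite_eq', hi, if_true, Pi.zero_apply] at h
  simpa using congrFun (congrFun h (p i).1) (p i).2

/-- The word of the path through the entries `00`, then `01` at step `j`, then `11`. -/
def stepWord {n : ℕ} (j i : Fin n) : Fin 3 := if i < j then 0 else if i = j then 1 else 2

lemma stepWord_eq_one {n : ℕ} {j i : Fin n} : stepWord j i = 1 ↔ i = j := by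
  unfold stepWord
  split_ifs with h h'
  · simpa using h.ne
  · simpa using h'
  · simpa using h'

lemma diag_mul_prod_eq {F : Type*} [Field F] {n : ℕ} (c : Fin (n + 1) → F) (v : Fin n → UT F) :
    !![c 0, 0; 0, 1] * (List.ofFn fun i : Fin n =>
      (v i : Matrix (Fin 2) (Fin 2) F) * !![c i.succ, 0; 0, 1]).prod =
    !![(∏ i, c i) * ∏ i, utCoord 0 (v i : Matrix (Fin 2) (Fin 2) F),
      ∑ j : Fin n, (∏ i, if i ≤ j.castSucc then c i else 1) *
        ∏ i, utCoord (stepWord j i) (v i : Matrix (Fin 2) (Fin 2) F);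
      0, ∏ i, utCoord 2 (v i : Matrix (Fin 2) (Fin 2) F)] := by
  induction n with
  | zero => ext i j; fin_cases i <;> fin_cases j <;> simp
  | succ n ih =>
    have h := ih (fun i => c i.succ) (fun i => v i.succ)
    rw [List.ofFn_succ, List.prod_cons, Matrix.mul_assoc, h]
    have hv : (v 0 : Matrix (Fin 2) (Fin 2) F) 1 0 = 0 := (v 0).2
    simp only [Fin.prod_univ_succ, Fin.sum_univ_succ, stepWord]
    ext i j
    fin_cases i <;> fin_cases j <;>
      simp [Matrix.mul_apply, Fin.sum_univ_succ, hv, utCoord, Finset.mul_sum, -Fin.succ_zero_eq_one,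
        -Fin.succ_zero_eq_one']
    · ring
    · rw [mul_add, add_comm, Finset.mul_sum]
      congr 1
      exact Finset.sum_congr rfl fun x _ => by ring

/-- The evaluation map of the generalized monomial given by a permutation and by the upper left
entries of the diagonal coefficients. -/
def monomialMap {F : Type*} [Field F] {n : ℕ} (σ : Equiv.Perm (Fin n)) (c : Fin (n + 1) → F) :
    (Fin n → UT F) → Matrix (Fin 2) (Fin 2) F :=
  fun a => !![c 0, 0; 0, 1] * (List.ofFn fun i : Fin n =>
    (a (σ i) : Matrix (Fin 2) (Fin 2) F) * !![c i.succ, 0; 0, 1]).prod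

lemma monomialMap_eq {F : Type*} [Field F] {n : ℕ} (σ : Equiv.Perm (Fin n))
    (c : Fin (n + 1) → F) :
    monomialMap σ c = (∏ i, c i) • wordMap F (fun _ => 0) (0, 0) + wordMap F (fun _ => 2) (1, 1) +
      ∑ j : Fin n, (∏ i, if i ≤ j.castSucc then c i else 1) •
        wordMap F (fun k => stepWord j (σ.symm k)) (0, 1) := by
  funext a
  have h0 (x : Fin 3) : ∏ k, utCoord x (a k : Matrix (Fin 2) (Fin 2) F) =
      ∏ i, utCoord x (a (σ i) : Matrix (Fin 2) (Fin 2) F) :=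
    (Equiv.prod_comp σ fun k => utCoord x (a k : Matrix (Fin 2) (Fin 2) F)).symm
  have h1 (j : Fin n) :
      ∏ k, utCoord (stepWord j (σ.symm k)) (a k : Matrix (Fin 2) (Fin 2) F) =
      ∏ i, utCoord (stepWord j i) (a (σ i) : Matrix (Fin 2) (Fin 2) F) := by
    rw [← Equiv.prod_comp σ]; simp
  rw [monomialMap, diag_mul_prod_eq c fun i => a (σ i)]
  simp only [wordMap, Pi.add_apply, Pi.smul_apply, Finset.sum_apply, h0, h1]
  ext i j
  fin_cases i <;> fin_cases j <;> simp [Matrix.sum_apply]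

/-- Index type of the basis words in `n = m + 1` letters. -/
abbrev WordIndex (m : ℕ) := Bool ⊕ (Fin (m + 1) × (Fin m → Bool))

/-- The basis words: the two constant ones, and those with the letter `1` exactly once. -/
def basisWord {m : ℕ} : WordIndex m → Fin (m + 1) → Fin 3
  | .inl b => fun _ => if b then 0 else 2
  | .inr (i, v) => i.insertNth 1 fun k => if v k then 0 else 2

/-- The matrix position attached to a basis word. -/
def basisPos {m : ℕ} : WordIndex m → Fin 2 × Fin 2
  | .inl b => if b then (0, 0) else (1, 1)
  | .inr _ => (0, 1)

lemma basisWord_inr_eq_one {m : ℕ} {i k : Fin (m + 1)} {v : Fin m → Bool} :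
    basisWord (.inr (i, v)) k = 1 ↔ k = i := by
  rcases Fin.eq_self_or_eq_succAbove i k with rfl | ⟨k, rfl⟩
  · simp [basisWord]
  · simp only [basisWord, Fin.insertNth_apply_succAbove, Fin.succAbove_ne, iff_false]
    split_ifs <;> decide

lemma basisWord_injective (m : ℕ) : Function.Injective (basisWord (m := m)) := by
  have hne (b : Bool) (i : Fin (m + 1)) (v : Fin m → Bool) :
      basisWord (.inl b) ≠ basisWord (.inr (i, v)) := by
    intro h
    have h1 := (congrFun h i).trans (basisWord_inr_eq_one.mpr rfl)
    cases b <;> simp [basisWord] at h1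
  rintro (b | ⟨i, v⟩) (b' | ⟨i', v'⟩) h
  · have := congrFun h 0
    cases b <;> cases b' <;> simp_all [basisWord]
  · exact (hne _ _ _ h).elim
  · exact (hne _ _ _ h.symm).elim
  · obtain rfl : i = i' :=
      basisWord_inr_eq_one.mp ((congrFun h i).symm.trans (basisWord_inr_eq_one.mpr rfl))
    congr 2
    funext k
    have := congrFun h (i.succAbove k)
    simp only [basisWord, Fin.insertNth_apply_succAbove] at this
    cases hv : v k <;> cases hv' : v' k <;> simp_all

/-- The basis of the space of multilinear generalized monomial maps. -/
def basisMap (F : Type*) [Field F] {m : ℕ} (x : WordIndex m) :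
    (Fin (m + 1) → UT F) → Matrix (Fin 2) (Fin 2) F :=
  wordMap F (basisWord x) (basisPos x)

lemma exists_basisMap_eq (F : Type*) [Field F] {m : ℕ} {w : Fin (m + 1) → Fin 3}
    {i : Fin (m + 1)} (hw : ∀ k, w k = 1 ↔ k = i) :
    ∃ x : WordIndex m, basisMap F x = wordMap F w (0, 1) := by
  refine ⟨.inr (i, fun k => w (i.succAbove k) = 0), ?_⟩
  unfold basisMap
  congr 1
  funext k
  rcases Fin.eq_self_or_eq_succAbove i k with rfl | ⟨k, rfl⟩
  · simp [basisWord, (hw k).mpr rfl]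
  · have := (hw (i.succAbove k)).not.mpr (Fin.succAbove_ne i k)
    simp only [basisWord, Fin.insertNth_apply_succAbove, decide_eq_true_eq]
    generalize w (i.succAbove k) = y at this ⊢
    revert this
    decide +revert

lemma exists_stepWord_eq {n : ℕ} {w : Fin n → Fin 3} {i : Fin n} (hw : ∀ k, w k = 1 ↔ k = i) :
    ∃ (σ : Equiv.Perm (Fin n)) (j : Fin n), w = fun k => stepWord j (σ.symm k) := by
  have hmono := Tuple.monotone_sort w
  set σ := Tuple.sort w
  refine ⟨σ, σ.symm i, ?_⟩
  funext k
  obtain ⟨l, rfl⟩ := σ.surjective k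
  obtain ⟨j, rfl⟩ := σ.surjective i
  have hj : w (σ j) = 1 := (hw _).mpr rfl
  have hl := hw (σ l)
  simp only [Equiv.symm_apply_apply, EmbeddingLike.apply_eq_iff_eq] at hl ⊢
  unfold stepWord
  split_ifs with h h'
  · have h1 : w (σ l) ≤ w (σ j) := hmono h.le
    have h2 := hl.not.mpr h.ne
    omega
  · exact hl.mpr h'
  · have h1 : w (σ j) ≤ w (σ l) := hmono (not_lt.mp h)
    have h2 := hl.not.mpr h'
    omega

/-- The span of the monomial maps with coefficients `1` and `e₂₂`. -/
def monomialSpan (F : Type*) [Field F] (n : ℕ) :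
    Submodule F ((Fin n → UT F) → Matrix (Fin 2) (Fin 2) F) :=
  Submodule.span F {f | ∃ (σ : Equiv.Perm (Fin n)) (c : Fin (n + 1) → F),
    (∀ i, c i = 1 ∨ c i = 0) ∧ f = monomialMap σ c}

lemma wordMap_two_mem (F : Type*) [Field F] (n : ℕ) :
    wordMap F (fun _ : Fin n => 2) (1, 1) ∈ monomialSpan F n := by
  refine Submodule.subset_span ⟨1, fun _ => 0, fun _ => Or.inr rfl, ?_⟩
  have (j : Fin n) : (∏ i : Fin (n + 1), if i ≤ j.castSucc then (0 : F) else 1) = 0 :=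
    Finset.prod_eq_zero (Finset.mem_univ 0) (by simp)
  simp [monomialMap_eq, this]

lemma wordMap_step_mem (F : Type*) [Field F] {n : ℕ} (σ : Equiv.Perm (Fin n)) (j : Fin n) :
    wordMap F (fun k => stepWord j (σ.symm k)) (0, 1) ∈ monomialSpan F n := by
  have hmem (p : Fin (n + 1) → Prop) [DecidablePred p] :
      monomialMap σ (fun i => if p i then (1 : F) else 0) ∈ monomialSpan F n :=
    Submodule.subset_span ⟨σ, _, fun i => by split_ifs <;> simp, rfl⟩
  have key := (monomialSpan F n).sub_mem (hmem (· ≤ j.castSucc)) (hmem (· < j.castSucc))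
  have hle : (∏ i : Fin (n + 1), if i ≤ j.castSucc then (1 : F) else 0) = 0 :=
    Finset.prod_eq_zero (Finset.mem_univ (Fin.last n)) (by simp [Fin.le_def])
  have hlt : (∏ i : Fin (n + 1), if i < j.castSucc then (1 : F) else 0) = 0 :=
    Finset.prod_eq_zero (Finset.mem_univ j.castSucc) (by simp)
  have hle' (l : Fin n) : (∏ i : Fin (n + 1), if i ≤ l.castSucc then
      (if i ≤ j.castSucc then (1 : F) else 0) else 1) = if l ≤ j then 1 else 0 := by
    split_ifs with h
    · refine Finset.prod_eq_one fun i _ => ?_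
      split_ifs with h1 h2
      · rfl
      · exact (h2 (h1.trans h)).elim
      · rfl
    · exact Finset.prod_eq_zero (Finset.mem_univ l.castSucc) (by simpa using h)
  have hlt' (l : Fin n) : (∏ i : Fin (n + 1), if i ≤ l.castSucc then
      (if i < j.castSucc then (1 : F) else 0) else 1) = if l < j then 1 else 0 := by
    split_ifs with h
    · refine Finset.prod_eq_one fun i _ => ?_
      split_ifs with h1 h2
      · rfl
      · exact (h2 (h1.trans_lt h)).elim
      · rfl
    · exact Finset.prod_eq_zero (Finset.mem_univ l.castSucc) (by simpa using h)
  rw [monomialMap_eq, monomialMap_eq, hle, hlt, add_sub_add_left_eq_sub,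
    ← Finset.sum_sub_distrib] at key
  simp only [hle', hlt', ← sub_smul] at key
  rw [Finset.sum_eq_single j] at key
  · simpa using key
  · intro l _ hl
    have : l ≤ j ↔ l < j := ⟨fun h => lt_of_le_of_ne h hl, le_of_lt⟩
    simp [this]
  · simp

lemma wordMap_zero_mem (F : Type*) [Field F] (n : ℕ) :
    wordMap F (fun _ : Fin n => 0) (0, 0) ∈ monomialSpan F n := by
  have h : monomialMap (1 : Equiv.Perm (Fin n)) (fun _ => (1 : F)) ∈ monomialSpan F n :=
    Submodule.subset_span ⟨1, _, fun _ => Or.inl rfl, rfl⟩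
  rw [monomialMap_eq, add_assoc, Finset.prod_const_one, one_smul] at h
  exact ((monomialSpan F n).add_mem_iff_left (add_mem (wordMap_two_mem F n)
    (sum_mem fun j _ => Submodule.smul_mem _ _ (wordMap_step_mem F 1 j)))).mp h

lemma monomialSpan_eq (F : Type*) [Field F] (m : ℕ) :
    monomialSpan F (m + 1) = Submodule.span F (Set.range (basisMap F (m := m))) := by
  apply le_antisymm
  · refine Submodule.span_le.mpr ?_
    rintro _ ⟨σ, c, -, rfl⟩
    rw [monomialMap_eq]
    refine add_mem (add_mem (Submodule.smul_mem _ _ ?_) ?_)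
      (sum_mem fun j _ => Submodule.smul_mem _ _ ?_)
    · exact Submodule.subset_span ⟨.inl true, by simp [basisMap, basisPos, basisWord]⟩
    · exact Submodule.subset_span ⟨.inl false, by simp [basisMap, basisPos, basisWord]⟩
    · exact Submodule.subset_span (exists_basisMap_eq F (i := σ j) fun k => by
        rw [stepWord_eq_one, Equiv.symm_apply_eq])
  · refine Submodule.span_le.mpr ?_
    rintro _ ⟨b | ⟨i, v⟩, rfl⟩
    · cases b
      · simpa [basisMap, basisPos, basisWord] using wordMap_two_mem F (m + 1)
      · simpa [basisMap, basisPos, basisWord] using wordMap_zero_mem F (m + 1)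
    · obtain ⟨σ, j, h⟩ := exists_stepWord_eq fun k =>
        basisWord_inr_eq_one (i := i) (k := k) (v := v)
      rw [basisMap, h]
      exact wordMap_step_mem F σ j

lemma diag_mem_iff {F : Type*} [Field F] (A : Matrix (Fin 2) (Fin 2) F) :
    A ∈ ({1, e22 F} : Set (Matrix (Fin 2) (Fin 2) F)) ↔
      ∃ c : F, (c = 1 ∨ c = 0) ∧ A = !![c, 0; 0, 1] := by
  simp [e22, Matrix.one_fin_two, or_and_right, exists_or]

/-- Fix `n ≥ 1`. The `F`-span of all evaluations of multilinear generalized monomials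
`(a₁,…,aₙ) ↦ u₀·a_{σ(1)}·u₁·a_{σ(2)}·u₂ ⋯ u_{n−1}·a_{σ(n)}·uₙ`, where `σ ∈ Sₙ` and each
`uⱼ ∈ {1, e₂₂}`, has dimension exactly `n·2^{n−1} + 2`; this is the `n`-th generalized
codimension `gcₙ(UT₂^D)` of `UT₂` as a `UT₂`-algebra under the action where `1` and `e₂₂`
act by multiplication and `e₁₂` acts as zero. -/
theorem generalized_codimension_UT2D (F : Type*) [Field F] [CharZero F] (n : ℕ) (hn : 1 ≤ n) :
    Module.finrank F (Submodule.span F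
      {f : (Fin n → UT F) → Matrix (Fin 2) (Fin 2) F |
        ∃ (σ : Equiv.Perm (Fin n)) (u : Fin (n + 1) → Matrix (Fin 2) (Fin 2) F),
          (∀ j, u j ∈ ({1, e22 F} : Set (Matrix (Fin 2) (Fin 2) F))) ∧
          f = fun a => u 0 * (List.ofFn fun i : Fin n =>
            (↑(a (σ i)) : Matrix (Fin 2) (Fin 2) F) * u i.succ).prod})
      = n * 2 ^ (n - 1) + 2 := by
  obtain ⟨m, rfl⟩ : ∃ m, n = m + 1 := ⟨n - 1, by omega⟩
  have hcard : Fintype.card (WordIndex m) = (m + 1) * 2 ^ (m + 1 - 1) + 2 := by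
    simp [add_comm]
  rw [← hcard, ← finrank_span_eq_card
    (linearIndependent_wordMap F (basisWord_injective m) basisPos)]
  change _ = Module.finrank F (Submodule.span F (Set.range (basisMap F)))
  rw [← monomialSpan_eq, monomialSpan]
  refine congrArg (fun s => Module.finrank F (Submodule.span F s)) (Set.ext fun f => ?_)
  simp only [diag_mem_iff, Set.mem_ofPred_eq]
  constructor
  · rintro ⟨σ, u, hu, rfl⟩
    choose c hc hu using hu
    obtain rfl : u = fun j => !![c j, 0; 0, 1] := funext hu
    exact ⟨σ, c, hc, rfl⟩
  · rintro ⟨σ, c, hc, rfl⟩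
    exact ⟨σ, fun j => !![c j, 0; 0, 1], fun j => ⟨c j, hc j, rfl⟩, rfl⟩
end

section
/- Fix n ≥ 1. Let S_F be the set of all n-linear maps UT2^n → M2(F) of the form (a_1, …, a_n) ↦ a_{σ(1)} · a_{σ(2)} ⋯ a_{σ(n)}, where σ ranges over the symmetric group S_n. Then the dimension d of the F-vector space spanned by S_F satisfies (d : ℤ) = (n−2)·2^{n−1} + 2. (This is the n-th generalized codimension gc_n(UT2^F) of UT2 regarded as a UT2-algebra under the action in which 1 acts by multiplication and e22, e12 act as zero; equivalently it is the classical ordinary codimension c_n(UT2) of the algebra of 2×2 upper triangular matrices.) -/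
/-- The edges `S → insert j S` of the Boolean lattice of subsets of `Fin n`. -/
abbrev BoolEdge (n : ℕ) := {p : Finset (Fin n) × Fin n // p.2 ∉ p.1}

/-- The sum of the edge weights `w` along the path that starts at `S` and inserts the
entries of a list one after the other. -/
def pathSum {α R : Type*} [DecidableEq α] [AddCommMonoid R] (w : Finset α → α → R) :
    Finset α → List α → R
  | _, [] => 0
  | S, j :: l => w S j + pathSum w (insert j S) l

theorem pathSum_append {α R : Type*} [DecidableEq α] [AddCommMonoid R]
    (w : Finset α → α → R) (S : Finset α) (l l' : List α) :
    pathSum w S (l ++ l') = pathSum w S l + pathSum w (S ∪ l.toFinset) l' := by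
  induction l generalizing S with
  | nil => simp [pathSum]
  | cons j l ih =>
    simp only [List.cons_append, pathSum, ih, List.toFinset_cons, add_assoc,
      Finset.insert_union, Finset.union_insert]

theorem pathSum_gradient {α R : Type*} [DecidableEq α] [AddCommGroup R]
    (φ : Finset α → R) (S : Finset α) (l : List α) :
    pathSum (fun S j => φ (insert j S) - φ S) S l = φ (S ∪ l.toFinset) - φ S := by
  induction l generalizing S with
  | nil => simp [pathSum]
  | cons j l ih =>
    simp only [pathSum, ih, List.toFinset_cons, Finset.insert_union, Finset.union_insert]
    abel

/-- Weights all of whose maximal paths have the same sum form a gradient. -/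
theorem weight_eq_gradient {α R : Type*} [DecidableEq α] [Fintype α] [AddCommGroup R]
    (w : Finset α → α → R) (c : R)
    (hw : ∀ l : List α, l.Nodup → l.toFinset = Finset.univ → pathSum w ∅ l = c)
    (S : Finset α) (j : α) (hj : j ∉ S) :
    w S j = pathSum w ∅ (insert j S).toList - pathSum w ∅ S.toList := by
  have h₁ := hw ((S.toList ++ [j]) ++ (insert j S)ᶜ.toList)
    (by
      simp only [List.nodup_append, Finset.nodup_toList, Finset.mem_toList]
      simp
      grind)
    (by ext x; simp; tauto)
  have h₂ := hw ((insert j S).toList ++ (insert j S)ᶜ.toList)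
    (by
      simp only [List.nodup_append, Finset.nodup_toList, Finset.mem_toList]
      simp
      grind)
    (by ext x; simp; tauto)
  have hS : S ∪ {j} = insert j S := by ext; simp
  simp only [pathSum_append, pathSum, List.toFinset_append, Finset.toList_toFinset,
    Finset.empty_union, List.toFinset_cons, List.toFinset_nil, insert_empty_eq, hS, add_zero] at h₁ h₂
  rw [eq_sub_iff_add_eq, add_comm]
  exact add_right_cancel (h₁.trans h₂.symm)

theorem exists_perm_ofFn_eq {n : ℕ} (l : List (Fin n)) (hl : l.Nodup)
    (hu : l.toFinset = Finset.univ) : ∃ σ : Equiv.Perm (Fin n), List.ofFn σ = l := by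
  have hlen : l.length = n := by
    rw [← List.toFinset_card_of_nodup hl, hu, Finset.card_univ, Fintype.card_fin]
  refine ⟨(finCongr hlen.symm).trans (hl.getEquivOfForallMemList l fun x => ?_), ?_⟩
  · rw [← List.mem_toFinset, hu]
    exact Finset.mem_univ x
  · apply List.ext_getElem <;> simp [hlen]

theorem nodup_ofFn_perm {n : ℕ} (σ : Equiv.Perm (Fin n)) : (List.ofFn σ).Nodup :=
  List.nodup_ofFn.2 σ.injective

theorem toFinset_ofFn_perm {n : ℕ} (σ : Equiv.Perm (Fin n)) :
    (List.ofFn σ).toFinset = Finset.univ := by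
  ext x
  simpa using σ.surjective x

theorem prod_map_ofFn_perm {R : Type*} [CommMonoid R] {n : ℕ} (σ : Equiv.Perm (Fin n))
    (g : Fin n → R) : ((List.ofFn σ).map g).prod = ∏ i, g i := by
  rw [List.map_ofFn, List.prod_ofFn]
  exact Equiv.prod_comp σ g

/-- Extend weights on the edges of the Boolean lattice by zero. -/
def extendWeight {n : ℕ} {F : Type*} [Zero F] (w : BoolEdge n → F)
    (S : Finset (Fin n)) (j : Fin n) : F :=
  if h : j ∉ S then w ⟨(S, j), h⟩ else 0

/-- The incidence matrix of maximal paths and edges of the Boolean lattice, together with a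
column of ones. -/
def pathMatrix (F : Type*) [Field F] (n : ℕ) :
    Matrix (Equiv.Perm (Fin n)) (Option (BoolEdge n)) F :=
  fun σ o => o.elim 1 fun p =>
    pathSum (fun S j => if p.1 = (S, j) then 1 else 0) ∅ (List.ofFn σ)

theorem sum_pathSum_mul {F : Type*} [Field F] {n : ℕ} (w : BoolEdge n → F)
    (S : Finset (Fin n)) (l : List (Fin n)) :
    ∑ p : BoolEdge n, pathSum (fun S j => if p.1 = (S, j) then (1 : F) else 0) S l * w p =
      pathSum (extendWeight w) S l := by
  induction l generalizing S with
  | nil => simp [pathSum]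
  | cons j l ih =>
    simp only [pathSum, add_mul, Finset.sum_add_distrib, ih, add_left_inj, extendWeight]
    by_cases h : j ∉ S
    · rw [dif_pos h, Finset.sum_eq_single ⟨(S, j), h⟩]
      · simp
      · intro p _ hp
        rw [if_neg (fun e => hp (Subtype.ext e)), zero_mul]
      · simp
    · rw [dif_neg h]
      refine Finset.sum_eq_zero fun p _ => ?_
      rw [if_neg, zero_mul]
      intro e
      have := p.2
      rw [e] at this
      exact h this

theorem pathMatrix_mulVec {F : Type*} [Field F] {n : ℕ} (v : Option (BoolEdge n) → F)
    (σ : Equiv.Perm (Fin n)) :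
    (pathMatrix F n).mulVec v σ =
      v none + pathSum (extendWeight fun p => v (some p)) ∅ (List.ofFn σ) := by
  simp [Matrix.mulVec, dotProduct, Fintype.sum_option, pathMatrix, sum_pathSum_mul]

/-- The gradient of a function on the Boolean lattice, completed by minus its total increment. -/
def latticeGradient (F : Type*) [Field F] (n : ℕ) :
    (Finset (Fin n) → F) →ₗ[F] (Option (BoolEdge n) → F) where
  toFun φ o := o.elim (φ ∅ - φ Finset.univ) fun p => φ (insert p.1.2 p.1.1) - φ p.1.1
  map_add' φ ψ := by
    ext (_ | p) <;> simp <;> ring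
  map_smul' c φ := by
    ext (_ | p) <;> simp <;> ring

theorem extendWeight_gradient {F : Type*} [Field F] {n : ℕ} (φ : Finset (Fin n) → F) :
    extendWeight (fun p : BoolEdge n => φ (insert p.1.2 p.1.1) - φ p.1.1) =
      fun S j => φ (insert j S) - φ S := by
  funext S j
  by_cases h : j ∈ S <;> simp [extendWeight, h]

theorem range_latticeGradient (F : Type*) [Field F] (n : ℕ) :
    LinearMap.range (latticeGradient F n) = LinearMap.ker (pathMatrix F n).mulVecLin := by
  ext v
  rw [LinearMap.mem_ker, Matrix.mulVecLin_apply]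
  constructor
  · rintro ⟨φ, rfl⟩
    funext σ
    rw [pathMatrix_mulVec]
    simp [latticeGradient, extendWeight_gradient, pathSum_gradient, toFinset_ofFn_perm]
  · intro hv
    have hw (l : List (Fin n)) (hl : l.Nodup) (hu : l.toFinset = Finset.univ) :
        pathSum (extendWeight fun p => v (some p)) ∅ l = -v none := by
      obtain ⟨σ, rfl⟩ := exists_perm_ofFn_eq l hl hu
      have := congrFun hv σ
      rw [pathMatrix_mulVec, Pi.zero_apply] at this
      exact eq_neg_of_add_eq_zero_right this
    refine ⟨fun S => pathSum (extendWeight fun p => v (some p)) ∅ S.toList, ?_⟩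
    funext o
    rcases o with _ | ⟨⟨S, j⟩, h⟩
    · simp only [latticeGradient, LinearMap.coe_mk, AddHom.coe_mk, Option.elim_none]
      rw [hw _ (Finset.nodup_toList _) (Finset.toList_toFinset _)]
      simp [pathSum]
    · simp only [latticeGradient, LinearMap.coe_mk, AddHom.coe_mk, Option.elim_some]
      rw [← weight_eq_gradient _ _ hw S j h]
      simp only [extendWeight, dif_pos h]

theorem ker_latticeGradient (F : Type*) [Field F] (n : ℕ) :
    LinearMap.ker (latticeGradient F n) = Submodule.span F {1} := by
  ext φ
  rw [LinearMap.mem_ker, Submodule.mem_span_singleton]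
  constructor
  · intro h
    refine ⟨φ ∅, ?_⟩
    funext S
    induction S using Finset.induction_on with
    | empty => simp
    | insert j S hj ih =>
      have := congrFun h (some ⟨(S, j), hj⟩)
      simp only [latticeGradient, LinearMap.coe_mk, AddHom.coe_mk, Option.elim_some,
        Pi.zero_apply, sub_eq_zero] at this
      rw [this, ← ih]
      rfl
  · rintro ⟨c, rfl⟩
    ext (_ | p) <;> simp [latticeGradient]

theorem card_boolEdge (n : ℕ) : Fintype.card (BoolEdge n) = n * 2 ^ (n - 1) := by
  have e : BoolEdge n ≃ Σ j : Fin n, {S : Finset (Fin n) // j ∉ S} :=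
    { toFun := fun p => ⟨p.1.2, p.1.1, p.2⟩
      invFun := fun q => ⟨(q.2.1, q.1), q.2.2⟩
      left_inv := fun _ => rfl
      right_inv := fun _ => rfl }
  have h (j : Fin n) : Fintype.card {S : Finset (Fin n) // j ∉ S} = 2 ^ (n - 1) := by
    rw [Fintype.card_of_subtype (Finset.univ.erase j).powerset]
    · simp
    · intro S
      simp [Finset.subset_erase]
  rw [Fintype.card_congr e, Fintype.card_sigma]
  simp [h]

theorem rank_pathMatrix (F : Type*) [Field F] (n : ℕ) :
    (pathMatrix F n).rank + 2 ^ n = n * 2 ^ (n - 1) + 2 := by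
  have h₁ := (pathMatrix F n).mulVecLin.finrank_range_add_finrank_ker
  have h₂ := (latticeGradient F n).finrank_range_add_finrank_ker
  rw [ker_latticeGradient, finrank_span_singleton one_ne_zero, range_latticeGradient] at h₂
  simp only [Module.finrank_fintype_fun_eq_card, Fintype.card_option, card_boolEdge,
    Fintype.card_finset, Fintype.card_fin] at h₁ h₂
  rw [Matrix.rank]
  omega

/-- The value at a tuple of upper triangular matrices of the monomial attached to the edge
`S → insert j S`. -/
def edgeMonomial {F : Type*} [Field F] {n : ℕ} (a : Fin n → UT F)
    (S : Finset (Fin n)) (j : Fin n) : F :=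
  (∏ i ∈ S, (a i).1 0 0) * (a j).1 0 1 * ∏ i ∈ (insert j S)ᶜ, (a i).1 1 1

theorem extendWeight_of_notMem {F : Type*} [Field F] {n : ℕ} (a : Fin n → UT F)
    (S : Finset (Fin n)) (j : Fin n) (hj : j ∉ S) :
    extendWeight (fun p => edgeMonomial a p.1.1 p.1.2) S j = edgeMonomial a S j := by
  simp [extendWeight, hj]

theorem prod_apply_one_zero {F : Type*} [Field F] {n : ℕ} (a : Fin n → UT F)
    (l : List (Fin n)) : (l.map fun i => (a i).1).prod 1 0 = 0 := by
  induction l with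
  | nil => simp
  | cons j l ih =>
    have : (a j).1 1 0 = 0 := (a j).2
    simp [Matrix.mul_apply, ih, this]

theorem prod_apply_zero_zero {F : Type*} [Field F] {n : ℕ} (a : Fin n → UT F)
    (l : List (Fin n)) :
    (l.map fun i => (a i).1).prod 0 0 = (l.map fun i => (a i).1 0 0).prod := by
  induction l with
  | nil => simp
  | cons j l ih => simp [Matrix.mul_apply, ih, prod_apply_one_zero]

theorem prod_apply_one_one {F : Type*} [Field F] {n : ℕ} (a : Fin n → UT F)
    (l : List (Fin n)) :
    (l.map fun i => (a i).1).prod 1 1 = (l.map fun i => (a i).1 1 1).prod := by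
  induction l with
  | nil => simp
  | cons j l ih =>
    have : (a j).1 1 0 = 0 := (a j).2
    simp [Matrix.mul_apply, ih, this]

theorem pathSum_edgeMonomial {F : Type*} [Field F] {n : ℕ} (a : Fin n → UT F)
    (S : Finset (Fin n)) (l : List (Fin n)) (hl : l.Nodup) (hS : l.toFinset = Sᶜ) :
    pathSum (extendWeight fun p => edgeMonomial a p.1.1 p.1.2) S l =
      (∏ i ∈ S, (a i).1 0 0) * (l.map fun i => (a i).1).prod 0 1 := by
  induction l generalizing S with
  | nil => simp [pathSum]
  | cons j l ih =>
    obtain ⟨hjl, hl⟩ := List.nodup_cons.1 hl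
    have hj : j ∉ S := by
      rw [← Finset.mem_compl, ← hS]
      simp
    have hS' : l.toFinset = (insert j S)ᶜ := by
      rw [Finset.compl_insert, ← hS, List.toFinset_cons, Finset.erase_insert]
      simpa using hjl
    rw [pathSum, ih _ hl hS', extendWeight_of_notMem a S j hj, edgeMonomial, ← hS',
      List.prod_toFinset _ hl, Finset.prod_insert hj, List.map_cons, List.prod_cons,
      Matrix.mul_apply, Fin.sum_univ_two, prod_apply_one_one]
    ring

/-- The function on tuples of upper triangular matrices with prescribed coefficients on the
edge monomials and on the diagonal. -/
def edgeFunction (F : Type*) [Field F] (n : ℕ) :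
    (Option (BoolEdge n) → F) →ₗ[F] ((Fin n → UT F) → Matrix (Fin 2) (Fin 2) F) where
  toFun v a := !![v none * ∏ i, (a i).1 0 0,
    ∑ p : BoolEdge n, v (some p) * edgeMonomial a p.1.1 p.1.2;
    0, v none * ∏ i, (a i).1 1 1]
  map_add' v w := by
    funext a
    ext i j
    fin_cases i <;> fin_cases j <;> simp [add_mul, Finset.sum_add_distrib]
  map_smul' c v := by
    funext a
    ext i j
    fin_cases i <;> fin_cases j <;> simp [Finset.mul_sum, mul_assoc]

theorem edgeFunction_pathMatrix {F : Type*} [Field F] {n : ℕ} (σ : Equiv.Perm (Fin n)) :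
    edgeFunction F n (pathMatrix F n σ) =
      fun a => (List.ofFn fun i : Fin n => (a (σ i)).1).prod := by
  funext a
  have hl : (List.ofFn fun i : Fin n => (a (σ i)).1) = (List.ofFn σ).map fun i => (a i).1 := by
    rw [List.map_ofFn]
    rfl
  have h₀₁ := pathSum_edgeMonomial a ∅ (List.ofFn σ) (nodup_ofFn_perm σ)
    (by rw [toFinset_ofFn_perm, Finset.compl_empty])
  rw [Finset.prod_empty, one_mul, ← sum_pathSum_mul] at h₀₁
  rw [hl]
  ext i j
  fin_cases i <;> fin_cases j
  · simp only [Fin.zero_eta, prod_apply_zero_zero, prod_map_ofFn_perm]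
    simp [edgeFunction, pathMatrix]
  · simpa [edgeFunction, pathMatrix] using h₀₁
  · simp only [Fin.mk_one, Fin.zero_eta, prod_apply_one_zero]
    simp [edgeFunction]
  · simp only [Fin.mk_one, prod_apply_one_one, prod_map_ofFn_perm]
    simp [edgeFunction, pathMatrix]

/-- The tuple of matrix units dual to the edge `S → insert j S`. -/
def edgePoint (F : Type*) [Field F] {n : ℕ} (S : Finset (Fin n)) (j : Fin n) :
    Fin n → UT F := fun i =>
  ⟨!![if i ∈ S then 1 else 0, if i = j then 1 else 0; 0, if i ∈ insert j S then 0 else 1], rfl⟩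

theorem edgeMonomial_edgePoint {F : Type*} [Field F] {n : ℕ} (p q : BoolEdge n) :
    edgeMonomial (edgePoint F p.1.1 p.1.2) q.1.1 q.1.2 = if q = p then 1 else 0 := by
  obtain ⟨⟨S, j⟩, hj⟩ := p
  obtain ⟨⟨T, k⟩, hk⟩ := q
  simp only at hj hk
  simp only [edgeMonomial, edgePoint, Matrix.of_apply, Matrix.cons_val', Matrix.cons_val_zero,
    Matrix.cons_val_one, Matrix.cons_val_fin_one, Subtype.mk.injEq, Prod.mk.injEq]
  split_ifs with h₁ h₂ h₂
  · obtain ⟨rfl, -⟩ := h₂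
    rw [Finset.prod_eq_one fun i hi => if_pos hi,
      Finset.prod_eq_one fun i hi => ?_, one_mul, one_mul]
    rw [if_neg]
    subst h₁
    exact Finset.mem_compl.1 hi
  · subst h₁
    by_cases hTS : T ⊆ S
    · obtain ⟨x, hxS, hxT⟩ := Finset.not_subset.1 fun hST => h₂ ⟨hTS.antisymm hST, rfl⟩
      rw [Finset.prod_eq_zero (i := x) (s := (insert k T)ᶜ), mul_zero]
      · have : x ≠ k := fun e => hj (e ▸ hxS)
        simp [hxT, this]
      · simp [hxS]
    · obtain ⟨x, hxT, hxS⟩ := Finset.not_subset.1 hTS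
      rw [Finset.prod_eq_zero hxT (if_neg hxS), zero_mul, zero_mul]
  · exact absurd h₂.2 h₁
  · rw [mul_zero, zero_mul]

theorem edgeFunction_injective (F : Type*) [Field F] (n : ℕ) :
    Function.Injective (edgeFunction F n) := by
  rw [injective_iff_map_eq_zero]
  intro v hv
  funext o
  rcases o with _ | p
  · have := congrFun (congrFun (congrFun hv fun _ => ⟨!![1, 0; 0, 0], rfl⟩) 0) 0
    simpa [edgeFunction] using this
  · have := congrFun (congrFun (congrFun hv (edgePoint F p.1.1 p.1.2)) 0) 1
    simpa [edgeFunction, edgeMonomial_edgePoint] using this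

/-- Fix `n ≥ 1`. The `F`-span of the multilinear maps
`(a₁,…,aₙ) ↦ a_{σ(1)}·a_{σ(2)} ⋯ a_{σ(n)}`, where `σ ∈ Sₙ`, has dimension `d` with
`(d : ℤ) = (n−2)·2^{n−1} + 2`; this is the `n`-th generalized codimension `gcₙ(UT₂^F)`,
i.e. the ordinary codimension `cₙ(UT₂)` of the `2×2` upper triangular matrices. -/
theorem generalized_codimension_UT2F (F : Type*) [Field F] [CharZero F] (n : ℕ) (hn : 1 ≤ n) :
    (Module.finrank F (Submodule.span F
      {f : (Fin n → UT F) → Matrix (Fin 2) (Fin 2) F |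
        ∃ σ : Equiv.Perm (Fin n),
          f = fun a => (List.ofFn fun i : Fin n =>
            (↑(a (σ i)) : Matrix (Fin 2) (Fin 2) F)).prod}) : ℤ)
      = ((n : ℤ) - 2) * 2 ^ (n - 1) + 2 := by
  have hset : {f : (Fin n → UT F) → Matrix (Fin 2) (Fin 2) F |
        ∃ σ : Equiv.Perm (Fin n),
          f = fun a => (List.ofFn fun i : Fin n =>
            (↑(a (σ i)) : Matrix (Fin 2) (Fin 2) F)).prod} =
      edgeFunction F n '' Set.range (pathMatrix F n).row := by
    ext f
    constructor
    · rintro ⟨σ, rfl⟩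
      exact ⟨_, ⟨σ, rfl⟩, edgeFunction_pathMatrix σ⟩
    · rintro ⟨_, ⟨σ, rfl⟩, rfl⟩
      exact ⟨σ, edgeFunction_pathMatrix σ⟩
  rw [hset, Submodule.span_image,
    ← (Submodule.equivMapOfInjective _ (edgeFunction_injective F n) _).finrank_eq,
    ← Matrix.rank_eq_finrank_span_row]
  have h := rank_pathMatrix F n
  obtain ⟨m, rfl⟩ := Nat.exists_eq_add_of_le' hn
  simp only [Nat.add_sub_cancel] at h ⊢
  zify at h
  push_cast
  linear_combination h
end
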